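/- arXiv:math/0507172 — 2 statements merged into one kernel-verified Lean document; each statement's English description precedes it below -/
import Mathlib

section
/- Let F be an n×n complex matrix-valued function on ℂ+ such that F is analytic (entrywise holomorphic) and, for all z ∈ ℂ+, Im F(z) ≥ 0 and Im(zF(z)) ≥ 0 (as Hermitian matrices). Then there exist a Hermitian positive semidefinite n×n matrix C and a positive n×n matrix-valued measure μ carried by ℝ+ with Tr(∫_{[0,∞)} (1+t)⁻¹ μ(dt)) < ∞ such that F(z) = C + ∫_{[0,∞)} (t − z)⁻¹ μ(dt) for all z ∈ ℂ+. -/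
open MeasureTheory Matrix Complex
open scoped ComplexOrder

noncomputable section

/-- The "imaginary part" `(M - M*) / (2i)` of a square complex matrix. -/
def matIm {d : ℕ} (M : Matrix (Fin d) (Fin d) ℂ) : Matrix (Fin d) (Fin d) ℂ :=
  (2 * Complex.I)⁻¹ • (M - Mᴴ)

open Filter Topology Metric

instance instMSCircle : MeasurableSpace Circle := borel Circle

instance instBSCircle : BorelSpace Circle := ⟨rfl⟩

/-- normalized arc length on the circle -/
def circP : Measure Circle :=
  (ENNReal.ofReal (2 * Real.pi)⁻¹) • (volume.restrict (Set.Ioc 0 (2 * Real.pi))).map Circle.exp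

instance : IsFiniteMeasure circP := by
  unfold circP
  refine Measure.smul_finite _ ENNReal.ofReal_ne_top

lemma circP_integral {E : Type*} [NormedAddCommGroup E] [NormedSpace ℝ E] (f : ℂ → E)
    (hf : Continuous fun ζ : Circle => f ζ) :
    ∫ ζ : Circle, f ζ ∂circP = Real.circleAverage f 0 1 := by
  have h2 : (0:ℝ) ≤ 2 * Real.pi := by positivity
  unfold circP
  rw [integral_smul_measure, integral_map (by fun_prop) hf.aestronglyMeasurable, Real.circleAverage_def,
    ENNReal.toReal_ofReal (by positivity), intervalIntegral.integral_of_le h2]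
  simp [circleMap]

lemma circP_cont_integrable {E : Type*} [NormedAddCommGroup E] [NormedSpace ℝ E]
    (ν : Measure Circle) [IsFiniteMeasure ν] {f : Circle → E}
    (hf : Continuous f) : Integrable f ν := by
  have := hf.continuousOn.integrableOn_compact (μ := ν) isCompact_univ
  simpa using this

lemma diffCont_cont {h : ℂ → ℂ} (hh : DiffContOnCl ℂ h (ball 0 1)) :
    Continuous fun ζ : Circle => h ζ := by
  have h1 := hh.continuousOn
  rw [closure_ball _ one_ne_zero] at h1
  exact h1.comp_continuous (by fun_prop) (fun ζ => by simp [Circle.norm_coe])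

lemma circP_mean {h : ℂ → ℂ} (hh : DiffContOnCl ℂ h (ball 0 1)) :
    ∫ ζ : Circle, h ζ ∂circP = h 0 := by
  rw [circP_integral h (diffCont_cont hh)]
  exact DiffContOnCl.circleAverage (by simpa using hh)

lemma circle_sub_ne {w : ℂ} (hw : ‖w‖ < 1) (ζ : Circle) : (ζ : ℂ) - w ≠ 0 := by
  intro h
  have : (ζ : ℂ) = w := sub_eq_zero.mp h
  rw [← this] at hw
  simp [Circle.norm_coe] at hw

lemma kern_cont {w : ℂ} (hw : ‖w‖ < 1) :
    Continuous fun ζ : Circle => ((ζ : ℂ) + w) / ((ζ : ℂ) - w) :=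
  Continuous.div (by fun_prop) (by fun_prop) (circle_sub_ne hw)

lemma circP_poisson {h : ℂ → ℂ} (hh : DiffContOnCl ℂ h (ball 0 1)) {w : ℂ} (hw : ‖w‖ < 1) :
    ∫ ζ : Circle, ((((ζ : ℂ) + w) / ((ζ : ℂ) - w)).re : ℂ) * h ζ ∂circP = h w := by
  have := hh.circleAverage_re_herglotzRieszKernel_smul' (w := w) (by simpa using hw)
  simp only [sub_zero] at this
  rw [← circP_integral] at this
  · simpa using this
  · exact (Complex.continuous_re.comp (kern_cont hw)).smul (diffCont_cont hh)

lemma circle_conj_inv (ζ : Circle) : (starRingEnd ℂ) (ζ : ℂ) = (ζ : ℂ)⁻¹ := by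
  rw [← Circle.coe_inv_eq_conj, Circle.coe_inv]

lemma circP_herglotz {h : ℂ → ℂ} (hh : DiffContOnCl ℂ h (ball 0 1)) {w : ℂ} (hw : ‖w‖ < 1) :
    ∫ ζ : Circle, (((ζ : ℂ) + w) / ((ζ : ℂ) - w)) * ((h ζ).re : ℂ) ∂circP
      = h w - I * (h 0).im := by
  have hc := diffCont_cont hh
  have hk := kern_cont hw
  set c := (starRingEnd ℂ) w with hcdef
  have hcn : ‖c‖ < 1 := by simpa [hcdef] using hw
  have hne : ∀ z ∈ closedBall (0:ℂ) 1, (1 - c * z) ≠ 0 := by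
    intro z hz h0
    have h1 : c * z = 1 := (sub_eq_zero.mp h0).symm
    have h2 : ‖c‖ * ‖z‖ = 1 := by rw [← norm_mul, h1]; simp
    have h3 : ‖z‖ ≤ 1 := by simpa using hz
    nlinarith [norm_nonneg c, norm_nonneg z]
  have hq : DiffContOnCl ℂ (fun z => (1 + c * z) / (1 - c * z)) (ball 0 1) := by
    apply DifferentiableOn.diffContOnCl
    rw [closure_ball _ one_ne_zero]
    intro z hz
    have e1 : DifferentiableAt ℂ (fun z : ℂ => 1 + c * z) z := by fun_prop
    have e2 : DifferentiableAt ℂ (fun z : ℂ => 1 - c * z) z := by fun_prop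
    exact (e1.div e2 (hne z hz)).differentiableWithinAt
  have hqh : DiffContOnCl ℂ (fun z => ((1 + c * z) / (1 - c * z)) * h z) (ball 0 1) := by
    simpa using hq.smul hh
  have hH := circP_mean hqh
  simp only [mul_zero, add_zero, sub_zero, div_one, one_mul] at hH
  have hP := circP_poisson hh hw
  have hconj : ∀ ζ : Circle, (starRingEnd ℂ) (((ζ : ℂ) + w) / ((ζ : ℂ) - w))
      = (1 + c * ζ) / (1 - c * ζ) := by
    intro ζ
    have hz : (ζ : ℂ) ≠ 0 := Circle.coe_ne_zero ζ
    have h1 := hne ζ (by simp [Circle.norm_coe])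
    have e : (ζ : ℂ)⁻¹ - c = (1 - c * ζ) / ζ := by field_simp
    have e' : (ζ : ℂ)⁻¹ + c = (1 + c * ζ) / ζ := by field_simp
    simp only [map_div₀, map_add, map_sub, circle_conj_inv, ← hcdef]
    rw [e, e']
    field_simp
  have key : ∀ ζ : Circle, (((ζ : ℂ) + w) / ((ζ : ℂ) - w)) * ((h ζ).re : ℂ)
      = ((((ζ : ℂ) + w) / ((ζ : ℂ) - w)).re : ℂ) * h ζ
        - (1/2 : ℂ) * (((1 + c * ζ) / (1 - c * ζ)) * h ζ)
        + (1/2 : ℂ) * (starRingEnd ℂ) (((1 + c * ζ) / (1 - c * ζ)) * h ζ) := by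
    intro ζ
    rw [← hconj]
    generalize (((ζ : ℂ) + w) / ((ζ : ℂ) - w)) = k
    generalize h ζ = g
    apply Complex.ext <;> simp <;> ring
  have i1 := circP_cont_integrable circP (diffCont_cont hqh)
  have i1' : Integrable (fun ζ : Circle => (starRingEnd ℂ) (((1 + c * ζ) / (1 - c * ζ)) * h ζ)) circP :=
    circP_cont_integrable circP (Complex.continuous_conj.comp (diffCont_cont hqh))
  have i2 : Integrable (fun ζ : Circle => ((((ζ : ℂ) + w) / ((ζ : ℂ) - w)).re : ℂ) * h ζ) circP :=
    circP_cont_integrable circP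
      ((Complex.continuous_ofReal.comp (Complex.continuous_re.comp hk)).mul hc)
  have i3 := i1.const_mul (1/2 : ℂ)
  have i3' := i1'.const_mul (1/2 : ℂ)
  have i4 := i2.sub i3
  have e := integral_add i4 i3'
  have e2 := integral_sub i2 i3
  simp only [Pi.sub_apply] at e
  rw [integral_congr_ae (ae_of_all _ key), e, e2, integral_const_mul, integral_const_mul,
    integral_conj, hP, hH]
  apply Complex.ext <;> simp <;> ring

/-- the function `ζ ↦ G (r ζ)` -/
lemma scale_diffCont {G : ℂ → ℂ} (hG : DifferentiableOn ℂ G (ball 0 1)) {r : ℝ}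
    (hr : r ∈ Set.Ioo (0:ℝ) 1) : DiffContOnCl ℂ (fun ζ => G (r * ζ)) (ball 0 1) := by
  apply DifferentiableOn.diffContOnCl
  rw [closure_ball _ one_ne_zero]
  refine hG.comp (by fun_prop) ?_
  intro z hz
  have h3 : ‖z‖ ≤ 1 := by simpa using hz
  simp only [mem_ball, dist_zero_right, norm_mul, Complex.norm_real, Real.norm_eq_abs, abs_of_pos hr.1]
  nlinarith [hr.1, hr.2, norm_nonneg z]

/-- fixed ultrafilter converging to `1` from the left -/
def UU : Ultrafilter ℝ := Ultrafilter.of (𝓝[<] (1:ℝ))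

lemma UU_le : (UU : Filter ℝ) ≤ 𝓝[<] (1:ℝ) := Ultrafilter.of_le _

lemma UU_mem : ∀ᶠ r in (UU : Filter ℝ), r ∈ Set.Ioo (0:ℝ) 1 :=
  UU_le (Ioo_mem_nhdsLT (by norm_num))

lemma UU_tendsto : Tendsto (fun r : ℝ => r) UU (𝓝 1) :=
  (tendsto_id.mono_left UU_le).mono_right nhdsWithin_le_nhds

/-- `ν` is the boundary measure of `G` -/
def IsBd (G : ℂ → ℂ) (ν : Measure Circle) : Prop :=
  IsFiniteMeasure ν ∧ ∀ φ : Circle → ℂ, Continuous φ →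
    Tendsto (fun r : ℝ => ∫ ζ : Circle, φ ζ * ((G (r * ζ)).re : ℂ) ∂circP) UU (𝓝 (∫ ζ, φ ζ ∂ν))

lemma re_mean {G : ℂ → ℂ} (hG : DifferentiableOn ℂ G (ball 0 1)) {r : ℝ}
    (hr : r ∈ Set.Ioo (0:ℝ) 1) : ∫ ζ : Circle, (G (r * ζ)).re ∂circP = (G 0).re := by
  have h := circP_mean (scale_diffCont hG hr)
  have hi := circP_cont_integrable circP (diffCont_cont (scale_diffCont hG hr))
  have h2 : ∫ ζ : Circle, (G (r * ζ)).re ∂circP = (∫ ζ : Circle, (G (r * ζ)) ∂circP).re :=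
    integral_re hi
  rw [h2, h]; simp

lemma exists_bd {G : ℂ → ℂ} (hG : DifferentiableOn ℂ G (ball 0 1))
    (hpos : ∀ w ∈ ball (0:ℂ) 1, 0 ≤ (G w).re) : ∃ ν, IsBd G ν := by
  have hpos' : ∀ r ∈ Set.Ioo (0:ℝ) 1, ∀ ζ : Circle, 0 ≤ (G (r * ζ)).re := by
    intro r hr ζ
    apply hpos
    simp [abs_of_pos hr.1, hr.2, Circle.norm_coe]
  have hcont : ∀ r ∈ Set.Ioo (0:ℝ) 1, Continuous fun ζ : Circle => (G (r * ζ)).re := fun r hr =>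
    Complex.continuous_re.comp (diffCont_cont (scale_diffCont hG hr))
  have hint : ∀ r ∈ Set.Ioo (0:ℝ) 1, Integrable (fun ζ : Circle => (G (r * ζ)).re) circP :=
    fun r hr => circP_cont_integrable circP (hcont r hr)
  classical
  let m : ℝ → FiniteMeasure Circle := fun r =>
    if hr : r ∈ Set.Ioo (0:ℝ) 1 then
      ⟨circP.withDensity (fun ζ => ENNReal.ofReal (G (r * ζ)).re),
        isFiniteMeasure_withDensity_ofReal (hint r hr).2⟩ else 0
  have hm : ∀ r ∈ Set.Ioo (0:ℝ) 1, (m r : Measure Circle)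
      = circP.withDensity (fun ζ => ENNReal.ofReal (G (r * ζ)).re) := by
    intro r hr
    have : m r = ⟨circP.withDensity (fun ζ => ENNReal.ofReal (G (r * ζ)).re),
        isFiniteMeasure_withDensity_ofReal (hint r hr).2⟩ := dif_pos hr
    rw [this]
    rfl
  have hmass : ∀ r, (m r).mass ≤ Real.toNNReal (G 0).re := by
    intro r
    by_cases hr : r ∈ Set.Ioo (0:ℝ) 1
    · rw [← ENNReal.coe_le_coe, FiniteMeasure.ennreal_mass, hm r hr, withDensity_apply _ MeasurableSet.univ,
        Measure.restrict_univ, ← ofReal_integral_eq_lintegral_ofReal (hint r hr)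
          (ae_of_all _ (hpos' r hr)), re_mean hG hr]
      rfl
    · simp [m, hr]
  obtain ⟨ν, -, hν⟩ := (isCompact_setOfPred_finiteMeasure_le_of_compactSpace Circle
    (Real.toNNReal (G 0).re)).ultrafilter_le_nhds (UU.map m) (by
      simp only [le_principal_iff]
      rw [Ultrafilter.coe_map, Filter.mem_map]
      exact Filter.univ_mem' hmass)
  have hν' : Tendsto m UU (𝓝 ν) := hν
  refine ⟨ν, inferInstance, ?_⟩
  rw [FiniteMeasure.tendsto_iff_forall_integral_rclike_tendsto ℂ] at hν'
  intro φ hφ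
  have := hν' (BoundedContinuousFunction.mkOfCompact ⟨φ, hφ⟩)
  refine this.congr' ?_
  filter_upwards [UU_mem] with r hr
  rw [hm r hr, integral_withDensity_eq_integral_toReal_smul]
  · apply integral_congr_ae
    refine ae_of_all _ fun ζ => ?_
    simp only [ENNReal.toReal_ofReal (hpos' r hr ζ), BoundedContinuousFunction.mkOfCompact_apply,
      ContinuousMap.coe_mk, Complex.real_smul]
    exact mul_comm _ _
  · exact (hcont r hr).measurable.ennreal_ofReal
  · exact ae_of_all _ fun _ => ENNReal.ofReal_lt_top

lemma bd_herglotz {G : ℂ → ℂ} (hG : DifferentiableOn ℂ G (ball 0 1)) {ν : Measure Circle}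
    (hν : IsBd G ν) {w : ℂ} (hw : ‖w‖ < 1) :
    ∫ ζ : Circle, (((ζ : ℂ) + w) / ((ζ : ℂ) - w)) ∂ν = G w - I * (G 0).im := by
  have h1 := hν.2 _ (kern_cont hw)
  have hGw : ContinuousAt G w :=
    (hG.differentiableAt (isOpen_ball.mem_nhds (by simpa using hw))).continuousAt
  have ht : Tendsto (fun r : ℝ => (r : ℂ) * w) UU (𝓝 w) := by
    have : Tendsto (fun r : ℝ => (r : ℂ) * w) UU (𝓝 (((1:ℝ) : ℂ) * w)) :=
      ((Complex.continuous_ofReal.tendsto 1).comp UU_tendsto).mul_const w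
    simpa using this
  have h2 : Tendsto (fun r : ℝ => G (r * w) - I * (G 0).im) UU (𝓝 (G w - I * (G 0).im)) :=
    (hGw.tendsto.comp ht).sub_const _
  refine tendsto_nhds_unique h1 (h2.congr' ?_)
  filter_upwards [UU_mem] with r hr
  rw [circP_herglotz (scale_diffCont hG hr) hw]
  simp

lemma bd_mass {G : ℂ → ℂ} (hG : DifferentiableOn ℂ G (ball 0 1)) {ν : Measure Circle}
    (hν : IsBd G ν) : ν.real Set.univ = (G 0).re := by
  have h := bd_herglotz hG hν (w := 0) (by simp)
  simp only [add_zero, sub_zero, div_self (Circle.coe_ne_zero _)] at h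
  simp only [integral_const] at h
  have := congrArg Complex.re h
  simpa using this

lemma zpow_cont (k : ℤ) : Continuous fun ζ : Circle => ((ζ ^ k : Circle) : ℂ) :=
  continuous_induced_dom.comp (continuous_zpow k)

lemma im_moment_nat {G : ℂ → ℂ} (hG : DifferentiableOn ℂ G (ball 0 1))
    (hpos : ∀ w ∈ ball (0:ℂ) 1, 0 ≤ (G w).re) (k : ℕ) {r : ℝ} (hr : r ∈ Set.Ioo (0:ℝ) 1) :
    ‖∫ ζ : Circle, (ζ : ℂ) ^ k * ((G (r * ζ)).im : ℂ) ∂circP‖ ≤ 2 * ‖G 0‖ := by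
  have hd := scale_diffCont hG hr
  have hc := diffCont_cont hd
  have hpos' : ∀ ζ : Circle, 0 ≤ (G (r * ζ)).re := by
    intro ζ
    apply hpos
    simp [abs_of_pos hr.1, hr.2, Circle.norm_coe]
  have hk : DiffContOnCl ℂ (fun z => z ^ k * G (r * z)) (ball 0 1) := by
    have : DiffContOnCl ℂ (fun z : ℂ => z ^ k) (ball 0 1) :=
      (Differentiable.diffContOnCl (by fun_prop))
    simpa using this.smul hd
  have hm := circP_mean hk
  have e1 : ‖∫ ζ : Circle, (ζ : ℂ) ^ k * G (r * ζ) ∂circP‖ ≤ ‖G 0‖ := by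
    rw [hm]
    simp only [mul_zero, norm_mul, norm_pow, norm_zero]
    rcases Nat.eq_zero_or_pos k with h | h
    · simp [h]
    · simp [h.ne']
  have e2 : ‖∫ ζ : Circle, (ζ : ℂ) ^ k * ((G (r * ζ)).re : ℂ) ∂circP‖ ≤ ‖G 0‖ := by
    refine (norm_integral_le_integral_norm _).trans ?_
    have : ∀ ζ : Circle, ‖(ζ : ℂ) ^ k * ((G (r * ζ)).re : ℂ)‖ = (G (r * ζ)).re := by
      intro ζ
      rw [norm_mul, norm_pow, Circle.norm_coe, one_pow, one_mul, Complex.norm_real,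
        Real.norm_eq_abs, abs_of_nonneg (hpos' ζ)]
    simp_rw [this]
    rw [re_mean hG hr]
    exact Complex.re_le_norm _
  have hcr : Continuous fun ζ : Circle => ((G (r * ζ)).re : ℂ) :=
    Complex.continuous_ofReal.comp (Complex.continuous_re.comp hc)
  have i1 : Integrable (fun ζ : Circle => (ζ : ℂ) ^ k * G (r * ζ)) circP :=
    circP_cont_integrable _ (Continuous.mul (by fun_prop) hc)
  have i2 : Integrable (fun ζ : Circle => (ζ : ℂ) ^ k * ((G (r * ζ)).re : ℂ)) circP :=
    circP_cont_integrable _ (Continuous.mul (by fun_prop) hcr)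
  have key : ∀ ζ : Circle, (ζ : ℂ) ^ k * ((G (r * ζ)).im : ℂ) =
      (-I) * ((ζ : ℂ) ^ k * G (r * ζ) - (ζ : ℂ) ^ k * ((G (r * ζ)).re : ℂ)) := by
    intro ζ
    conv_rhs => rw [← Complex.re_add_im (G (r * ζ))]
    simp only [Complex.add_re, Complex.ofReal_re, Complex.mul_re, Complex.I_re, Complex.I_im,
      Complex.ofReal_im, mul_zero, mul_one, sub_self, add_zero]
    linear_combination ((ζ : ℂ) ^ k * ((G (r * ζ)).im : ℂ)) * Complex.I_sq
  rw [integral_congr_ae (ae_of_all _ key), integral_const_mul, integral_sub i1 i2]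
  rw [norm_mul, norm_neg, Complex.norm_I, one_mul]
  refine (norm_sub_le _ _).trans ?_
  linarith

lemma im_moment {G : ℂ → ℂ} (hG : DifferentiableOn ℂ G (ball 0 1))
    (hpos : ∀ w ∈ ball (0:ℂ) 1, 0 ≤ (G w).re) (k : ℤ) {r : ℝ} (hr : r ∈ Set.Ioo (0:ℝ) 1) :
    ‖∫ ζ : Circle, ((ζ ^ k : Circle) : ℂ) * ((G (r * ζ)).im : ℂ) ∂circP‖ ≤ 2 * ‖G 0‖ := by
  rcases Int.eq_nat_or_neg k with ⟨m, rfl | rfl⟩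
  · simpa using im_moment_nat hG hpos m hr
  · have h := im_moment_nat hG hpos m hr
    rw [← Complex.norm_conj, ← integral_conj] at h
    refine le_of_eq_of_le (congrArg norm (integral_congr_ae (ae_of_all _ fun ζ => ?_))) h
    simp only [map_mul, map_pow, circle_conj_inv, Complex.conj_ofReal, _root_.zpow_neg, zpow_natCast,
      Circle.coe_inv, Circle.coe_pow, inv_pow]

lemma im_moment_tendsto {G : ℂ → ℂ} (hG : DifferentiableOn ℂ G (ball 0 1))
    (hpos : ∀ w ∈ ball (0:ℂ) 1, 0 ≤ (G w).re) (k : ℤ) :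
    Tendsto (fun r : ℝ => ((1 - r ^ 2 : ℝ) : ℂ) *
      ∫ ζ : Circle, ((ζ ^ k : Circle) : ℂ) * ((G (r * ζ)).im : ℂ) ∂circP) UU (𝓝 0) := by
  have h0 : Tendsto (fun r : ℝ => ‖((1 - r ^ 2 : ℝ) : ℂ)‖ * (2 * ‖G 0‖)) UU (𝓝 0) := by
    have hc : Continuous fun r : ℝ => ‖((1 - r ^ 2 : ℝ) : ℂ)‖ * (2 * ‖G 0‖) := by fun_prop
    have := (hc.tendsto 1).comp UU_tendsto
    simpa [Function.comp_def] using this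
  refine squeeze_zero_norm' ?_ h0
  filter_upwards [UU_mem] with r hr
  rw [norm_mul]
  exact mul_le_mul_of_nonneg_left (im_moment hG hpos k hr) (norm_nonneg _)

lemma rel_pointwise {G1 G2 w : ℂ} (h : (1 - w) * G2 = I * (1 + w) * G1) :
    (1 + ‖w‖ ^ 2 - 2 * w.re) * G2.re + 2 * w.im * G1.re = -((1 - ‖w‖ ^ 2) * G1.im) := by
  have h2 : (starRingEnd ℂ (1 - w)) * ((1 - w) * G2) = (starRingEnd ℂ (1 - w)) * (I * (1 + w) * G1) := by
    rw [h]
  have h3 := congrArg Complex.re h2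
  simp only [Complex.mul_re, Complex.mul_im, Complex.conj_re, Complex.conj_im, Complex.sub_re, Complex.sub_im,
    Complex.add_re, Complex.add_im, Complex.one_re, Complex.one_im, Complex.I_re, Complex.I_im] at h3
  rw [← Complex.normSq_eq_norm_sq, Complex.normSq_apply]
  linarith

lemma rel_zpow {G1 G2 : ℂ → ℂ} (hG1 : DifferentiableOn ℂ G1 (ball 0 1))
    (hG2 : DifferentiableOn ℂ G2 (ball 0 1))
    (hpos1 : ∀ w ∈ ball (0:ℂ) 1, 0 ≤ (G1 w).re)
    (hrel : ∀ w ∈ ball (0:ℂ) 1, (1 - w) * G2 w = I * (1 + w) * G1 w)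
    {ν1 ν2 : Measure Circle} (hν1 : IsBd G1 ν1) (hν2 : IsBd G2 ν2) (k : ℤ) :
    ∫ ζ : Circle, ((ζ ^ k : Circle) : ℂ) * ((1 - (ζ : ℂ).re : ℝ) : ℂ) ∂ν2
      + ∫ ζ : Circle, ((ζ ^ k : Circle) : ℂ) * (((ζ : ℂ).im : ℝ) : ℂ) ∂ν1 = 0 := by
  have := hν1.1
  have := hν2.1
  have c0 := zpow_cont k
  have cre : Continuous fun ζ : Circle => ((ζ ^ k : Circle) : ℂ) * (((ζ : ℂ).re : ℝ) : ℂ) := by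
    fun_prop
  have cim : Continuous fun ζ : Circle => ((ζ ^ k : Circle) : ℂ) * (((ζ : ℂ).im : ℝ) : ℂ) := by
    fun_prop
  have t0 := hν2.2 _ c0
  have t1 := hν2.2 _ cre
  have t2 := hν1.2 _ cim
  have t3 := im_moment_tendsto hG1 hpos1 k
  have s1 : Tendsto (fun r : ℝ => ((1 + r ^ 2 : ℝ) : ℂ)) UU (𝓝 2) := by
    have hc : Continuous fun r : ℝ => ((1 + r ^ 2 : ℝ) : ℂ) := by fun_prop
    have := (hc.tendsto 1).comp UU_tendsto
    have e : (((1 + (1:ℝ) ^ 2 : ℝ)) : ℂ) = 2 := by push_cast; norm_num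
    rw [e] at this
    exact this
  have s2 : Tendsto (fun r : ℝ => ((2 * r : ℝ) : ℂ)) UU (𝓝 2) := by
    have hc : Continuous fun r : ℝ => ((2 * r : ℝ) : ℂ) := by fun_prop
    have := (hc.tendsto 1).comp UU_tendsto
    have e : ((2 * (1:ℝ) : ℝ) : ℂ) = 2 := by push_cast; norm_num
    rw [e] at this
    exact this
  have T := (((s1.mul t0).sub (s2.mul t1)).add (s2.mul t2)).add t3
  have Z := tendsto_nhds_unique (T.congr' (f₂ := fun _ => (0:ℂ)) ?_) tendsto_const_nhds
  · have e1 : ∀ ζ : Circle, ((ζ ^ k : Circle) : ℂ) * ((1 - (ζ : ℂ).re : ℝ) : ℂ)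
        = ((ζ ^ k : Circle) : ℂ) - ((ζ ^ k : Circle) : ℂ) * (((ζ : ℂ).re : ℝ) : ℂ) := by
      intro ζ; push_cast; ring
    rw [integral_congr_ae (ae_of_all _ e1), integral_sub (circP_cont_integrable _ c0) (circP_cont_integrable _ cre)]
    linear_combination (1/2 : ℂ) * Z
  · filter_upwards [UU_mem] with r hr
    have hc1 := diffCont_cont (scale_diffCont hG1 hr)
    have hc2 := diffCont_cont (scale_diffCont hG2 hr)
    have cr2 : Continuous fun ζ : Circle => ((G2 (r * ζ)).re : ℂ) :=
      Complex.continuous_ofReal.comp (Complex.continuous_re.comp hc2)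
    have cr1 : Continuous fun ζ : Circle => ((G1 (r * ζ)).re : ℂ) :=
      Complex.continuous_ofReal.comp (Complex.continuous_re.comp hc1)
    have ci1 : Continuous fun ζ : Circle => ((G1 (r * ζ)).im : ℂ) :=
      Complex.continuous_ofReal.comp (Complex.continuous_im.comp hc1)
    rw [← integral_const_mul, ← integral_const_mul, ← integral_const_mul, ← integral_const_mul]
    have j0 := (circP_cont_integrable circP (c0.mul cr2)).const_mul ((1 + r ^ 2 : ℝ) : ℂ)
    have j1 := (circP_cont_integrable circP (cre.mul cr2)).const_mul ((2 * r : ℝ) : ℂ)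
    have j2 := (circP_cont_integrable circP (cim.mul cr1)).const_mul ((2 * r : ℝ) : ℂ)
    have j3 := (circP_cont_integrable circP (c0.mul ci1)).const_mul ((1 - r ^ 2 : ℝ) : ℂ)
    have q1 := integral_sub j0 j1
    have q2 := integral_add (j0.sub j1) j2
    have q3 := integral_add ((j0.sub j1).add j2) j3
    simp only [Pi.add_apply, Pi.sub_apply, Pi.mul_apply] at q1 q2 q3
    rw [← q1, ← q2, ← q3]
    refine (integral_congr_ae (ae_of_all _ fun ζ => ?_)).trans (integral_zero' _ _)
    have hw : (r * ζ : ℂ) ∈ ball (0:ℂ) 1 := by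
      simp [abs_of_pos hr.1, hr.2, Circle.norm_coe]
    have hp := rel_pointwise (hrel _ hw)
    have hn : ‖(r * ζ : ℂ)‖ = r := by simp [abs_of_pos hr.1, Circle.norm_coe]
    rw [hn] at hp
    have hre : (r * ζ : ℂ).re = r * (ζ : ℂ).re := by simp
    have him : (r * ζ : ℂ).im = r * (ζ : ℂ).im := by simp
    rw [hre, him] at hp
    have hp' := congrArg (fun x : ℝ => (x : ℂ)) hp
    push_cast at hp'
    simp only [Pi.zero_apply]
    push_cast
    linear_combination ((ζ : ℂ) ^ k) * hp'

lemma circ_ext {P P' : Measure Circle} [IsFiniteMeasure P] [IsFiniteMeasure P']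
    (h : ∀ k : ℤ, ∫ ζ : Circle, ((ζ ^ k : Circle) : ℂ) ∂P = ∫ ζ : Circle, ((ζ ^ k : Circle) : ℂ) ∂P') :
    P = P' := by
  let X : BoundedContinuousFunction Circle ℂ :=
    BoundedContinuousFunction.mkOfCompact ⟨fun ζ => (ζ : ℂ), continuous_induced_dom⟩
  have hX : ∀ ζ, X ζ = (ζ : ℂ) := fun ζ => rfl
  let A : StarSubalgebra ℂ (BoundedContinuousFunction Circle ℂ) := StarAlgebra.adjoin ℂ {X}
  have hA : (A.map (BoundedContinuousFunction.toContinuousMapStarₐ ℂ)).SeparatesPoints := by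
    intro a b hab
    refine ⟨X, ⟨BoundedContinuousFunction.toContinuousMapStarₐ ℂ X,
      ⟨X, StarAlgebra.subset_adjoin ℂ _ (Set.mem_singleton X), rfl⟩, rfl⟩, ?_⟩
    intro e
    exact hab (Circle.ext e)
  refine ext_of_forall_mem_subalgebra_integral_eq_of_polish hA ?_
  intro g hg
  have hg' : g ∈ Submodule.span ℂ (Submonoid.closure ({X} ∪ star {X}) : Set (BoundedContinuousFunction Circle ℂ)) := by
    rw [← StarAlgebra.adjoin_eq_span]
    exact hg
  have hmon : ∀ m ∈ Submonoid.closure ({X} ∪ star {X}), ∃ k : ℤ, ∀ ζ : Circle, m ζ = ((ζ ^ k : Circle) : ℂ) := by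
    intro m hm
    induction hm using Submonoid.closure_induction with
    | mem x hx =>
      rcases hx with hx | hx
      · rw [Set.mem_singleton_iff] at hx
        subst hx
        exact ⟨1, fun ζ => by simp [hX]⟩
      · rw [Set.mem_star, Set.mem_singleton_iff] at hx
        have hx' : x = star X := by rw [← hx, star_star]
        subst hx'
        refine ⟨-1, fun ζ => ?_⟩
        rw [BoundedContinuousFunction.star_apply, hX, _root_.zpow_neg_one, Circle.coe_inv_eq_conj]
        rfl
    | one => exact ⟨0, fun ζ => by simp⟩
    | mul x y _ _ hx hy =>
      obtain ⟨k, hk⟩ := hx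
      obtain ⟨l, hl⟩ := hy
      refine ⟨k + l, fun ζ => ?_⟩
      rw [BoundedContinuousFunction.mul_apply, hk, hl, _root_.zpow_add, Circle.coe_mul]
  induction hg' using Submodule.span_induction with
  | mem x hx =>
    obtain ⟨k, hk⟩ := hmon x hx
    simp only [hk]
    exact h k
  | zero => simp
  | add x y _ _ hx hy =>
    simp only [BoundedContinuousFunction.add_apply]
    rw [integral_add (circP_cont_integrable _ x.continuous) (circP_cont_integrable _ y.continuous),
      integral_add (circP_cont_integrable _ x.continuous) (circP_cont_integrable _ y.continuous)]
    rw [hx ?_, hy ?_]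
    · change y ∈ Subalgebra.toSubmodule A.toSubalgebra
      rw [StarAlgebra.adjoin_eq_span]; assumption
    · change x ∈ Subalgebra.toSubmodule A.toSubalgebra
      rw [StarAlgebra.adjoin_eq_span]; assumption
  | smul a x _ hx =>
    simp only [BoundedContinuousFunction.smul_apply]
    rw [integral_smul, integral_smul, hx ?_]
    change x ∈ Subalgebra.toSubmodule A.toSubalgebra
    rw [StarAlgebra.adjoin_eq_span]; assumption

lemma re_cont : Continuous fun ζ : Circle => (ζ : ℂ).re :=
  Complex.continuous_re.comp continuous_induced_dom
lemma im_cont : Continuous fun ζ : Circle => (ζ : ℂ).im :=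
  Complex.continuous_im.comp continuous_induced_dom

lemma wd_fin (ν : Measure Circle) [IsFiniteMeasure ν] {f : Circle → ℝ} (hf : Continuous f) :
    IsFiniteMeasure (ν.withDensity fun ζ => ENNReal.ofReal (f ζ)) :=
  isFiniteMeasure_withDensity_ofReal
    ((isCompact_univ.exists_bound_of_continuousOn hf.continuousOn).elim fun C hC => by
      have : Integrable f ν := by
        refine Integrable.of_bound hf.aestronglyMeasurable C (ae_of_all _ fun x => hC x trivial)
      exact this.2)

lemma wd_int (ν : Measure Circle) [IsFiniteMeasure ν] {f : Circle → ℝ} (hf : Continuous f)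
    (φ : Circle → ℂ) :
    ∫ ζ, φ ζ ∂(ν.withDensity fun ζ => ENNReal.ofReal (f ζ)) = ∫ ζ, φ ζ * ((max (f ζ) 0 : ℝ) : ℂ) ∂ν := by
  rw [integral_withDensity_eq_integral_toReal_smul hf.measurable.ennreal_ofReal
    (ae_of_all _ fun _ => ENNReal.ofReal_lt_top)]
  refine integral_congr_ae (ae_of_all _ fun ζ => ?_)
  simp only [ENNReal.toReal_ofReal', Complex.real_smul]
  ring

lemma rel_measure {G1 G2 : ℂ → ℂ} (hG1 : DifferentiableOn ℂ G1 (ball 0 1))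
    (hG2 : DifferentiableOn ℂ G2 (ball 0 1))
    (hpos1 : ∀ w ∈ ball (0:ℂ) 1, 0 ≤ (G1 w).re)
    (hrel : ∀ w ∈ ball (0:ℂ) 1, (1 - w) * G2 w = I * (1 + w) * G1 w)
    {ν1 ν2 : Measure Circle} (hν1 : IsBd G1 ν1) (hν2 : IsBd G2 ν2) :
    ν2.withDensity (fun ζ : Circle => ENNReal.ofReal (1 - (ζ : ℂ).re))
      + ν1.withDensity (fun ζ : Circle => ENNReal.ofReal ((ζ : ℂ).im))
      = ν1.withDensity (fun ζ : Circle => ENNReal.ofReal (-(ζ : ℂ).im)) := by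
  have := hν1.1
  have := hν2.1
  have c1 : Continuous fun ζ : Circle => 1 - (ζ : ℂ).re := continuous_const.sub re_cont
  have c2 := im_cont
  have c3 : Continuous fun ζ : Circle => -(ζ : ℂ).im := im_cont.neg
  have := wd_fin ν2 c1
  have := wd_fin ν1 c2
  have := wd_fin ν1 c3
  refine circ_ext fun k => ?_
  have cz := zpow_cont k
  rw [integral_add_measure (circP_cont_integrable _ cz) (circP_cont_integrable _ cz),
    wd_int _ c1, wd_int _ c2, wd_int _ c3]
  have h := rel_zpow hG1 hG2 hpos1 hrel hν1 hν2 k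
  have e1 : ∀ ζ : Circle, ((ζ ^ k : Circle) : ℂ) * ((max (1 - (ζ:ℂ).re) 0 : ℝ) : ℂ) =
      ((ζ ^ k : Circle) : ℂ) * ((1 - (ζ:ℂ).re : ℝ) : ℂ) := by
    intro ζ
    have : (ζ : ℂ).re ≤ 1 := by
      have := Complex.re_le_norm (ζ : ℂ)
      rwa [Circle.norm_coe] at this
    rw [max_eq_left (by linarith)]
  have e2 : ∀ ζ : Circle, ((ζ ^ k : Circle) : ℂ) * (((ζ:ℂ).im : ℝ) : ℂ) =
      ((ζ ^ k : Circle) : ℂ) * ((max ((ζ:ℂ).im) 0 : ℝ) : ℂ) -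
      ((ζ ^ k : Circle) : ℂ) * ((max (-(ζ:ℂ).im) 0 : ℝ) : ℂ) := by
    intro ζ
    rw [← mul_sub, ← Complex.ofReal_sub, max_zero_sub_max_neg_zero_eq_self]
  have d2 : Continuous fun ζ : Circle => ((max ((ζ:ℂ).im) 0 : ℝ) : ℂ) :=
    Complex.continuous_ofReal.comp (c2.max continuous_const)
  have d3 : Continuous fun ζ : Circle => ((max (-(ζ:ℂ).im) 0 : ℝ) : ℂ) :=
    Complex.continuous_ofReal.comp (c3.max continuous_const)
  rw [integral_congr_ae (ae_of_all _ e1)]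
  have i2 : Integrable (fun ζ : Circle => ((ζ ^ k : Circle) : ℂ) * ((max ((ζ:ℂ).im) 0 : ℝ) : ℂ)) ν1 :=
    circP_cont_integrable _ (cz.mul d2)
  have i3 : Integrable (fun ζ : Circle => ((ζ ^ k : Circle) : ℂ) * ((max (-(ζ:ℂ).im) 0 : ℝ) : ℂ)) ν1 :=
    circP_cont_integrable _ (cz.mul d3)
  rw [integral_congr_ae (ae_of_all _ e2), integral_sub i2 i3] at h
  linear_combination h

/-- the real coordinate of a point of the circle -/
def tt (ζ : Circle) : ℝ := -(ζ : ℂ).im * (1 - (ζ : ℂ).re)⁻¹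

lemma tt_meas : Measurable tt :=
  im_cont.measurable.neg.mul (measurable_const.sub re_cont.measurable).inv

lemma circ_re_le (ζ : Circle) : (ζ : ℂ).re ≤ 1 := by
  have := Complex.re_le_norm (ζ : ℂ)
  rwa [Circle.norm_coe] at this

lemma circ_sq (ζ : Circle) : (ζ : ℂ).re * (ζ : ℂ).re + (ζ : ℂ).im * (ζ : ℂ).im = 1 := by
  rw [← Complex.normSq_apply, Complex.normSq_eq_norm_sq, Circle.norm_coe, one_pow]

lemma circ_re_ne {ζ : Circle} (h : ζ ≠ 1) : 1 - (ζ : ℂ).re ≠ 0 := by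
  intro e
  apply h
  have h1 : (ζ : ℂ).re = 1 := by linarith
  have h2 := circ_sq ζ
  rw [h1] at h2
  have h3 : (ζ : ℂ).im = 0 := by nlinarith
  exact Circle.ext (Complex.ext (by simpa using h1) (by simpa using h3))

lemma tt_rel {ζ : Circle} (h : ζ ≠ 1) : (tt ζ : ℂ) * (1 - ζ) = I * (1 + ζ) := by
  have h1 := circ_re_ne h
  have h2 := circ_sq ζ
  have h3 : tt ζ * (1 - (ζ : ℂ).re) = -(ζ : ℂ).im := by
    unfold tt; field_simp
  have h4 : -(tt ζ * (ζ : ℂ).im) = 1 + (ζ : ℂ).re := by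
    unfold tt
    field_simp
    linarith
  apply Complex.ext
  · simpa using h3
  · simpa using h4

lemma rel_im {ν1 ν2 : Measure Circle}
    (hm : ν2.withDensity (fun ζ : Circle => ENNReal.ofReal (1 - (ζ : ℂ).re))
      + ν1.withDensity (fun ζ : Circle => ENNReal.ofReal ((ζ : ℂ).im))
      = ν1.withDensity (fun ζ : Circle => ENNReal.ofReal (-(ζ : ℂ).im))) :
    ∀ᵐ ζ : Circle ∂ν1, (ζ : ℂ).im ≤ 0 := by
  have h := congrArg (fun m : Measure Circle => m {ζ : Circle | 0 < (ζ : ℂ).im}) hm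
  simp only [Measure.add_apply] at h
  have m3 : Measurable fun ζ : Circle => ENNReal.ofReal (-(ζ : ℂ).im) :=
    im_cont.measurable.neg.ennreal_ofReal
  have h0 : ν1.withDensity (fun ζ : Circle => ENNReal.ofReal (-(ζ : ℂ).im)) {ζ : Circle | 0 < (ζ : ℂ).im} = 0 := by
    rw [withDensity_apply_eq_zero m3]
    convert measure_empty (μ := ν1)
    ext ζ
    simp only [ne_eq, ENNReal.ofReal_eq_zero, Set.mem_inter_iff, Set.mem_ofPred_eq, Set.mem_empty_iff_false]
    constructor
    · rintro ⟨h1, h2⟩; exact h1 (by linarith)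
    · simp
  rw [h0, add_eq_zero] at h
  have h2 := h.2
  rw [withDensity_apply_eq_zero im_cont.measurable.ennreal_ofReal] at h2
  rw [ae_iff]
  refine measure_mono_null ?_ h2
  intro ζ hζ
  simp only [Set.mem_ofPred_eq, not_le] at hζ
  simp only [ne_eq, ENNReal.ofReal_eq_zero, Set.mem_inter_iff, Set.mem_ofPred_eq, not_le]
  exact ⟨hζ, hζ⟩

lemma rel_lint {ν1 ν2 : Measure Circle}
    (hm : ν2.withDensity (fun ζ : Circle => ENNReal.ofReal (1 - (ζ : ℂ).re))
      + ν1.withDensity (fun ζ : Circle => ENNReal.ofReal ((ζ : ℂ).im))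
      = ν1.withDensity (fun ζ : Circle => ENNReal.ofReal (-(ζ : ℂ).im))) :
    ∫⁻ ζ, ENNReal.ofReal (tt ζ) ∂ν1 ≤ ν2 Set.univ := by
  have him := rel_im hm
  have mg : Measurable fun ζ : Circle => ENNReal.ofReal ((1 - (ζ : ℂ).re)⁻¹) :=
    (measurable_const.sub re_cont.measurable).inv.ennreal_ofReal
  have hg : ∀ ζ : Circle, 0 ≤ (1 - (ζ : ℂ).re)⁻¹ := fun ζ => inv_nonneg.2 (by linarith [circ_re_le ζ])
  have m1 : Measurable fun ζ : Circle => ENNReal.ofReal (1 - (ζ : ℂ).re) :=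
    (measurable_const.sub re_cont.measurable).ennreal_ofReal
  have m3 : Measurable fun ζ : Circle => ENNReal.ofReal (-(ζ : ℂ).im) :=
    im_cont.measurable.neg.ennreal_ofReal
  have h := congrArg (fun m : Measure Circle => ∫⁻ ζ : Circle, ENNReal.ofReal ((1 - (ζ : ℂ).re)⁻¹) ∂m) hm
  simp only [lintegral_add_measure] at h
  rw [lintegral_withDensity_eq_lintegral_mul _ m1 mg,
    lintegral_withDensity_eq_lintegral_mul _ im_cont.measurable.ennreal_ofReal mg,
    lintegral_withDensity_eq_lintegral_mul _ m3 mg] at h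
  have e3 : ∫⁻ ζ, ENNReal.ofReal (tt ζ) ∂ν1 =
    ∫⁻ a, ((fun ζ : Circle => ENNReal.ofReal (-(ζ : ℂ).im)) * fun ζ : Circle => ENNReal.ofReal ((1 - (ζ : ℂ).re)⁻¹)) a ∂ν1 := by
    refine lintegral_congr fun ζ => ?_
    simp only [Pi.mul_apply, tt]
    rw [ENNReal.ofReal_mul' (hg ζ)]
  have e2 : ∫⁻ a, ((fun ζ : Circle => ENNReal.ofReal ((ζ : ℂ).im)) * fun ζ : Circle => ENNReal.ofReal ((1 - (ζ : ℂ).re)⁻¹)) a ∂ν1 = 0 := by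
    rw [← lintegral_zero (μ := ν1)]
    refine lintegral_congr_ae ?_
    filter_upwards [him] with ζ hζ
    simp [ENNReal.ofReal_eq_zero.2 hζ]
  rw [e3, ← h, e2, add_zero]
  calc _ ≤ ∫⁻ _ζ : Circle, 1 ∂ν2 := by
        refine lintegral_mono fun ζ => ?_
        simp only [Pi.mul_apply]
        rw [← ENNReal.ofReal_mul (by linarith [circ_re_le ζ]), ← ENNReal.ofReal_one]
        exact ENNReal.ofReal_le_ofReal (mul_inv_le_one)
    _ = _ := by simp

lemma rel_tt {ν1 ν2 : Measure Circle} [IsFiniteMeasure ν2]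
    (hm : ν2.withDensity (fun ζ : Circle => ENNReal.ofReal (1 - (ζ : ℂ).re))
      + ν1.withDensity (fun ζ : Circle => ENNReal.ofReal ((ζ : ℂ).im))
      = ν1.withDensity (fun ζ : Circle => ENNReal.ofReal (-(ζ : ℂ).im))) :
    (∀ᵐ ζ ∂ν1, 0 ≤ tt ζ) ∧ Integrable tt ν1 ∧ ∫ ζ, tt ζ ∂ν1 ≤ ν2.real Set.univ := by
  have h0 : ∀ᵐ ζ ∂ν1, 0 ≤ tt ζ := by
    filter_upwards [rel_im hm] with ζ hζ
    exact mul_nonneg (by linarith) (inv_nonneg.2 (by linarith [circ_re_le ζ]))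
  have hl := rel_lint hm
  have hi : Integrable tt ν1 := by
    refine ⟨tt_meas.aestronglyMeasurable, ?_⟩
    rw [hasFiniteIntegral_iff_ofReal h0]
    exact hl.trans_lt (measure_lt_top _ _)
  refine ⟨h0, hi, ?_⟩
  rw [integral_eq_lintegral_of_nonneg_ae h0 tt_meas.aestronglyMeasurable, Measure.real]
  exact ENNReal.toReal_mono (measure_ne_top _ _) hl

/-- the scalar class -/
def SS (f : ℂ → ℂ) : Prop :=
  DifferentiableOn ℂ f {z : ℂ | 0 < z.im} ∧ ∀ z : ℂ, 0 < z.im → 0 ≤ (f z).im ∧ 0 ≤ (z * f z).im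

/-- Cayley transform -/
def zz (w : ℂ) : ℂ := I * (1 + w) / (1 - w)

/-- disc version -/
def GG (f : ℂ → ℂ) (w : ℂ) : ℂ := -I * f (zz w)

lemma one_sub_ne {w : ℂ} (hw : ‖w‖ < 1) : 1 - w ≠ 0 := by
  intro h
  have : w = 1 := by linear_combination -h
  rw [this] at hw
  simp at hw

lemma zz_im {w : ℂ} (hw : ‖w‖ < 1) : 0 < (zz w).im := by
  have h1 := one_sub_ne hw
  have e : (zz w).im = (1 - ‖w‖ ^ 2) / Complex.normSq (1 - w) := by
    unfold zz
    rw [Complex.div_im, ← Complex.normSq_eq_norm_sq, Complex.normSq_apply w]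
    simp
    ring
  rw [e]
  refine div_pos ?_ (Complex.normSq_pos.2 h1)
  nlinarith [norm_nonneg w]

lemma zz_diff : DifferentiableOn ℂ zz (ball 0 1) := by
  intro w hw
  have h1 := one_sub_ne (by simpa using hw)
  unfold zz
  refine DifferentiableWithinAt.div (by fun_prop) (by fun_prop) h1

lemma zz_zero : zz 0 = I := by simp [zz]

lemma zz_inv {z : ℂ} (hz : 0 < z.im) : ‖(z - I) / (z + I)‖ < 1 ∧ zz ((z - I) / (z + I)) = z := by
  have h0 : z + I ≠ 0 := by
    intro h
    have := congrArg Complex.im h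
    simp at this
    linarith
  constructor
  · rw [norm_div, div_lt_one (norm_pos_iff.2 h0)]
    rw [← sq_lt_sq₀ (norm_nonneg _) (norm_nonneg _), ← Complex.normSq_eq_norm_sq, ← Complex.normSq_eq_norm_sq,
      Complex.normSq_apply, Complex.normSq_apply]
    simp
    nlinarith
  · unfold zz
    have h2 : 1 - (z - I) / (z + I) = 2 * I / (z + I) := by
      field_simp; ring
    rw [h2]
    field_simp
    ring

lemma GG_diff {f : ℂ → ℂ} (hf : SS f) : DifferentiableOn ℂ (GG f) (ball 0 1) := by
  unfold GG
  have : DifferentiableOn ℂ (f ∘ zz) (ball 0 1) :=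
    hf.1.comp zz_diff fun w hw => zz_im (by simpa using hw)
  exact this.const_mul _

lemma GG_pos {f : ℂ → ℂ} (hf : SS f) : ∀ w ∈ ball (0:ℂ) 1, 0 ≤ (GG f w).re := by
  intro w hw
  have := (hf.2 _ (zz_im (w := w) (by simpa using hw))).1
  simpa [GG] using this

lemma GG2_diff {f : ℂ → ℂ} (hf : SS f) :
    DifferentiableOn ℂ (fun w => zz w * GG f w) (ball 0 1) := zz_diff.mul (GG_diff hf)

lemma GG2_pos {f : ℂ → ℂ} (hf : SS f) : ∀ w ∈ ball (0:ℂ) 1, 0 ≤ (zz w * GG f w).re := by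
  intro w hw
  have := (hf.2 _ (zz_im (w := w) (by simpa using hw))).2
  have e : zz w * GG f w = -I * (zz w * f (zz w)) := by unfold GG; ring
  rw [e]
  simpa using this

lemma GG_rel {f : ℂ → ℂ} : ∀ w ∈ ball (0:ℂ) 1, (1 - w) * (zz w * GG f w) = I * (1 + w) * GG f w := by
  intro w hw
  have h1 := one_sub_ne (w := w) (by simpa using hw)
  unfold zz
  field_simp

lemma bd_tt {f : ℂ → ℂ} (hf : SS f) {ν : Measure Circle} (hν : IsBd (GG f) ν) :
    (∀ᵐ ζ ∂ν, 0 ≤ tt ζ) ∧ Integrable tt ν ∧ ∫ ζ, tt ζ ∂ν ≤ (f I).re := by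
  obtain ⟨ν2, h2⟩ := exists_bd (GG2_diff hf) (GG2_pos hf)
  have := h2.1
  have h := rel_tt (rel_measure (GG_diff hf) (GG2_diff hf) (GG_pos hf) GG_rel hν h2)
  refine ⟨h.1, h.2.1, h.2.2.trans_eq ?_⟩
  rw [bd_mass (GG2_diff hf) h2, zz_zero]
  simp [GG, zz_zero]

lemma bd_rep {f : ℂ → ℂ} (hf : SS f) {ν : Measure Circle} (hν : IsBd (GG f) ν) {w : ℂ} (hw : ‖w‖ < 1) :
    f (zz w) = (f I).re + ∫ ζ : Circle, I * (((ζ : ℂ) + w) / ((ζ : ℂ) - w)) ∂ν := by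
  rw [integral_const_mul, bd_herglotz (GG_diff hf) hν hw]
  have : (GG f 0).im = -(f I).re := by simp [GG, zz_zero]
  rw [this]
  unfold GG
  push_cast
  linear_combination (f (zz w) - (f I).re) * Complex.I_sq

lemma kern_eq {z : ℂ} (hz : 0 < z.im) {ζ : Circle} (h : ζ ≠ 1) :
    I * (((ζ : ℂ) + (z - I) / (z + I)) / ((ζ : ℂ) - (z - I) / (z + I))) =
      (1 + tt ζ * z) / (tt ζ - z) := by
  have h0 : z + I ≠ 0 := by
    intro h
    have := congrArg Complex.im h
    simp at this
    linarith
  have h1 : (tt ζ : ℂ) - z ≠ 0 := by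
    intro h
    have := congrArg Complex.im h
    simp at this
    linarith
  have h2 : (tt ζ : ℂ) + I ≠ 0 := by
    intro h
    have := congrArg Complex.im h
    simp at this
  have h3 : (ζ : ℂ) - (z - I) / (z + I) ≠ 0 := circle_sub_ne (zz_inv hz).1 ζ
  have hr := tt_rel h
  have hζ : (ζ : ℂ) = (tt ζ - I) / (tt ζ + I) := by
    rw [eq_div_iff h2]
    linear_combination -hr
  rw [← mul_div_assoc, div_eq_div_iff h3 h1]
  generalize tt ζ = t at *
  rw [hζ]
  field_simp
  ring_nf
  simp only [Complex.I_sq, show I ^ 3 = -I from Complex.I_pow_three, Complex.I_pow_four]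
  ring

lemma kern_one {z : ℂ} (hz : 0 < z.im) :
    I * ((((1 : Circle) : ℂ) + (z - I) / (z + I)) / (((1 : Circle) : ℂ) - (z - I) / (z + I))) = z := by
  have := (zz_inv hz).2
  unfold zz at this
  rw [Circle.coe_one, ← mul_div_assoc]
  exact this

lemma sub_ne_of_im {z : ℂ} (hz : 0 < z.im) (t : ℝ) : (t : ℂ) - z ≠ 0 := by
  intro h
  have := congrArg Complex.im h
  simp at this
  linarith

lemma kern_im_le {x t : ℝ} (hx : 0 ≤ x) (ht : 0 ≤ t) :
    (((-x : ℝ) + I) * ((1 + t * ((-x : ℝ) + I)) / (t - ((-x : ℝ) + I))) : ℂ).im ≤ 0 := by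
  rw [← mul_div_assoc, Complex.div_im]
  rw [← sub_div]
  refine div_nonpos_of_nonpos_of_nonneg ?_ (Complex.normSq_nonneg _)
  simp
  nlinarith [mul_nonneg hx ht, mul_nonneg ht (mul_nonneg hx ht), mul_nonneg ht (mul_nonneg hx hx)]

lemma bd_atom {f : ℂ → ℂ} (hf : SS f) {ν : Measure Circle} (hν : IsBd (GG f) ν) : ν {1} = 0 := by
  have := hν.1
  obtain ⟨h0, hi, hle⟩ := bd_tt hf hν
  have main : ∀ x : ℝ, 0 ≤ x → 2 * x * ν.real {1} ≤ (f I).re := by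
    intro x hx
    set z : ℂ := (-x : ℝ) + I with hzdef
    have hz : 0 < z.im := by simp [hzdef]
    have hw := (zz_inv hz).1
    have hr := bd_rep hf hν hw
    rw [(zz_inv hz).2] at hr
    set K : Circle → ℂ := fun ζ => I * (((ζ : ℂ) + (z - I) / (z + I)) / ((ζ : ℂ) - (z - I) / (z + I))) with hK
    have cK : Continuous K := continuous_const.mul (kern_cont hw)
    have iK : Integrable (fun ζ => z * K ζ) ν := circP_cont_integrable _ (continuous_const.mul cK)
    have p := (hf.2 z hz).2
    have e : (z * f z).im = (f I).re + ∫ ζ, (z * K ζ).im ∂ν := by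
      have e2 : ∫ ζ, (z * K ζ).im ∂ν = (∫ ζ, z * K ζ ∂ν).im := integral_im iK
      rw [e2, integral_const_mul, hr, mul_add, Complex.add_im]
      congr 1
      simp [hzdef]
    have b : ∫ ζ, (z * K ζ).im ∂ν ≤ ∫ ζ, Set.indicator {1} (fun _ => -(2 * x)) ζ ∂ν := by
      refine integral_mono_ae iK.im ((integrable_const _).indicator (measurableSet_singleton _)) ?_
      filter_upwards [h0] with ζ hζ
      by_cases h1 : ζ = 1
      · subst h1
        simp only [Set.mem_singleton_iff, Set.indicator_of_mem]
        have : K 1 = z := kern_one hz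
        change (z * K 1).im ≤ _
        rw [this]
        simp [hzdef]
        linarith
      · rw [Set.indicator_of_notMem (by simpa using h1)]
        have : K ζ = _ := kern_eq hz h1
        change (z * K ζ).im ≤ _
        rw [this]
        exact kern_im_le hx hζ
    rw [integral_indicator_const _ (measurableSet_singleton _)] at b
    simp only [smul_eq_mul] at b
    rw [e] at p
    linarith
  have hz : ν.real {1} = 0 := by
    by_contra hne
    have hp : 0 < ν.real {1} := lt_of_le_of_ne measureReal_nonneg (Ne.symm hne)
    have h1 := main (((f I).re + 1) / (2 * ν.real {1})) (by
      have := main 0 le_rfl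
      simp only [mul_zero, zero_mul] at this
      positivity)
    have : 2 * (((f I).re + 1) / (2 * ν.real {1})) * ν.real {1} = (f I).re + 1 := by
      field_simp
    linarith
  exact (measureReal_eq_zero_iff).1 hz

/-- representing measure on the line -/
def HRep (f : ℂ → ℂ) (N : Measure ℝ) : Prop := ∃ ν, IsBd (GG f) ν ∧ N = ν.map tt

lemma rep_exists {f : ℂ → ℂ} (hf : SS f) : ∃ N, HRep f N := by
  obtain ⟨ν, hν⟩ := exists_bd (GG_diff hf) (GG_pos hf)
  exact ⟨_, ν, hν, rfl⟩

/-- the constant -/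
def cc (f : ℂ → ℂ) (N : Measure ℝ) : ℝ := (f I).re - ∫ t, t ∂N

lemma rep_fin {f : ℂ → ℂ} {N : Measure ℝ} (h : HRep f N) : IsFiniteMeasure N := by
  obtain ⟨ν, hν, rfl⟩ := h
  have := hν.1
  infer_instance

lemma rep_neg {f : ℂ → ℂ} (hf : SS f) {N : Measure ℝ} (h : HRep f N) : N (Set.Iio 0) = 0 := by
  obtain ⟨ν, hν, rfl⟩ := h
  rw [Measure.map_apply tt_meas measurableSet_Iio]
  have := (bd_tt hf hν).1
  rw [ae_iff] at this
  convert this using 2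
  ext ζ
  simp

lemma rep_int {f : ℂ → ℂ} (hf : SS f) {N : Measure ℝ} (h : HRep f N) : Integrable (fun t : ℝ => t) N := by
  obtain ⟨ν, hν, rfl⟩ := h
  rw [integrable_map_measure measurable_id'.aestronglyMeasurable tt_meas.aemeasurable]
  exact (bd_tt hf hν).2.1

lemma rep_cc {f : ℂ → ℂ} (hf : SS f) {N : Measure ℝ} (h : HRep f N) : 0 ≤ cc f N := by
  obtain ⟨ν, hν, rfl⟩ := h
  unfold cc
  rw [integral_map tt_meas.aemeasurable measurable_id'.aestronglyMeasurable]
  linarith [(bd_tt hf hν).2.2]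

lemma kern_meas (z : ℂ) : Measurable fun t : ℝ => (1 + (t : ℂ) ^ 2) / ((t : ℂ) - z) := by
  have : Measurable fun t : ℝ => (t : ℂ) := Complex.measurable_ofReal
  exact ((measurable_const.add (this.pow_const 2)).div (this.sub_const z))

lemma rep_eq {f : ℂ → ℂ} (hf : SS f) {N : Measure ℝ} (h : HRep f N) {z : ℂ} (hz : 0 < z.im) :
    Integrable (fun t : ℝ => (1 + (t : ℂ) ^ 2) / ((t : ℂ) - z)) N ∧
    f z = cc f N + ∫ t : ℝ, (1 + (t : ℂ) ^ 2) / ((t : ℂ) - z) ∂N := by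
  obtain ⟨ν, hν, rfl⟩ := h
  have := hν.1
  obtain ⟨h0, hi, hle⟩ := bd_tt hf hν
  have hw := (zz_inv hz).1
  have hr := bd_rep hf hν hw
  rw [(zz_inv hz).2] at hr
  set K : Circle → ℂ := fun ζ => I * (((ζ : ℂ) + (z - I) / (z + I)) / ((ζ : ℂ) - (z - I) / (z + I))) with hK
  have cK : Continuous K := continuous_const.mul (kern_cont hw)
  have iK : Integrable K ν := circP_cont_integrable _ cK
  have ne1 : ∀ᵐ ζ : Circle ∂ν, ζ ≠ 1 := by
    rw [ae_iff]
    simpa using bd_atom hf hν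
  have key : ∀ᵐ ζ ∂ν, K ζ + (tt ζ : ℂ) = (1 + (tt ζ : ℂ) ^ 2) / ((tt ζ : ℂ) - z) := by
    filter_upwards [ne1] with ζ hζ
    have : K ζ = _ := kern_eq hz hζ
    rw [this]
    have := sub_ne_of_im hz (tt ζ)
    field_simp
    ring
  have hiC : Integrable (fun ζ => (tt ζ : ℂ)) ν := hi.ofReal
  have i2 : Integrable (fun ζ => (1 + (tt ζ : ℂ) ^ 2) / ((tt ζ : ℂ) - z)) ν :=
    (iK.add hiC).congr key
  refine ⟨?_, ?_⟩
  · rw [integrable_map_measure (kern_meas z).aestronglyMeasurable tt_meas.aemeasurable]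
    exact i2
  · rw [integral_map tt_meas.aemeasurable (kern_meas z).aestronglyMeasurable,
      ← integral_congr_ae key, integral_add iK hiC, hr]
    unfold cc
    rw [integral_map tt_meas.aemeasurable measurable_id'.aestronglyMeasurable]
    have : ∫ ζ, (tt ζ : ℂ) ∂ν = ((∫ ζ, tt ζ ∂ν : ℝ) : ℂ) := integral_ofReal
    rw [this]
    push_cast
    ring

lemma rep_lin_measure {ι : Type} [Fintype ι] {f : ι → ℂ → ℂ} {N : ι → Measure ℝ}
    (hf : ∀ k, SS (f k)) (hR : ∀ k, HRep (f k) (N k)) (α : ι → ℝ)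
    (h : ∀ z : ℂ, 0 < z.im → ∑ k, (α k : ℂ) * f k z = 0) :
    ∑ k, (α k).toNNReal • N k = ∑ k, (-α k).toNNReal • N k := by
  choose ν hν hN using hR
  have := fun k => (hν k).1
  have hc : ∑ k, (α k).toNNReal • ν k = ∑ k, (-α k).toNNReal • ν k := by
    refine circ_ext fun m => ?_
    have cz := zpow_cont m
    rw [integral_finsetSum_measure (fun k _ => circP_cont_integrable _ cz),
      integral_finsetSum_measure (fun k _ => circP_cont_integrable _ cz), ← sub_eq_zero,
      ← Finset.sum_sub_distrib]
    have e : ∀ k, ∫ ζ : Circle, ((ζ ^ m : Circle) : ℂ) ∂((α k).toNNReal • ν k)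
        - ∫ ζ : Circle, ((ζ ^ m : Circle) : ℂ) ∂((-α k).toNNReal • ν k)
        = (α k : ℂ) * ∫ ζ : Circle, ((ζ ^ m : Circle) : ℂ) ∂(ν k) := by
      intro k
      rw [integral_smul_nnreal_measure, integral_smul_nnreal_measure, NNReal.smul_def, NNReal.smul_def,
        Complex.real_smul, Complex.real_smul, ← sub_mul, ← Complex.ofReal_sub,
        Real.coe_toNNReal', Real.coe_toNNReal', max_zero_sub_max_neg_zero_eq_self]
    rw [Finset.sum_congr rfl fun k _ => e k]
    have T : Tendsto (fun r : ℝ => ∑ k, (α k : ℂ) * ∫ ζ : Circle, ((ζ ^ m : Circle) : ℂ) *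
        ((GG (f k) (r * ζ)).re : ℂ) ∂circP) UU
        (𝓝 (∑ k, (α k : ℂ) * ∫ ζ : Circle, ((ζ ^ m : Circle) : ℂ) ∂(ν k))) :=
      tendsto_finsetSum _ fun k _ => ((hν k).2 _ cz).const_mul _
    refine tendsto_nhds_unique T (tendsto_const_nhds.congr' ?_)
    filter_upwards [UU_mem] with r hr
    symm
    have ii : ∀ k, Integrable (fun ζ : Circle => (α k : ℂ) * (((ζ ^ m : Circle) : ℂ) *
        ((GG (f k) (r * ζ)).re : ℂ))) circP := by
      intro k
      have hc1 := diffCont_cont (scale_diffCont (GG_diff (hf k)) hr)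
      exact (circP_cont_integrable _ (cz.mul (Complex.continuous_ofReal.comp
        (Complex.continuous_re.comp hc1)))).const_mul _
    simp_rw [← integral_const_mul]
    rw [← integral_finsetSum _ fun k _ => ii k]
    refine (integral_congr_ae (ae_of_all _ fun ζ => ?_)).trans (integral_zero' _ _)
    have hw : ‖(r * ζ : ℂ)‖ < 1 := by
      simp [abs_of_pos hr.1, hr.2, Circle.norm_coe]
    have h1 := congrArg Complex.im (h _ (zz_im hw))
    have h2 : ∑ k, α k * (GG (f k) (r * ζ)).re = 0 := by
      simpa [GG] using h1
    have h3 := congrArg (fun x : ℝ => (x : ℂ)) h2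
    push_cast at h3
    change ∑ k, (α k : ℂ) * (((ζ ^ m : Circle) : ℂ) * ((GG (f k) (r * ζ)).re : ℂ)) = 0
    calc _ = ((ζ ^ m : Circle) : ℂ) * ∑ k, (α k : ℂ) * ((GG (f k) (r * ζ)).re : ℂ) := by
          rw [Finset.mul_sum]
          refine Finset.sum_congr rfl fun k _ => ?_
          ring
      _ = 0 := by rw [h3, mul_zero]
  ext A hA
  have hB := congrArg (fun m : Measure Circle => m (tt ⁻¹' A)) hc
  simp only [Measure.coe_finsetSum, Finset.sum_apply, Measure.smul_apply] at hB ⊢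
  simp only [hN, Measure.map_apply tt_meas hA]
  exact hB

lemma rep_lin_real {ι : Type} [Fintype ι] {f : ι → ℂ → ℂ} {N : ι → Measure ℝ}
    (hf : ∀ k, SS (f k)) (hR : ∀ k, HRep (f k) (N k)) (α : ι → ℝ)
    (h : ∀ z : ℂ, 0 < z.im → ∑ k, (α k : ℂ) * f k z = 0)
    {φ : ℝ → ℂ} (hφ : ∀ k, Integrable φ (N k)) :
    ∑ k, (α k : ℂ) * ∫ t, φ t ∂(N k) = 0 := by
  have hm := congrArg (fun m : Measure ℝ => ∫ t, φ t ∂m) (rep_lin_measure hf hR α h)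
  rw [integral_finsetSum_measure (fun k _ => (hφ k).smul_measure_nnreal),
      integral_finsetSum_measure (fun k _ => (hφ k).smul_measure_nnreal), ← sub_eq_zero,
      ← Finset.sum_sub_distrib] at hm
  rw [← hm]
  refine Finset.sum_congr rfl fun k _ => ?_
  rw [integral_smul_nnreal_measure, integral_smul_nnreal_measure, NNReal.smul_def, NNReal.smul_def,
        Complex.real_smul, Complex.real_smul, ← sub_mul, ← Complex.ofReal_sub,
        Real.coe_toNNReal', Real.coe_toNNReal', max_zero_sub_max_neg_zero_eq_self]

lemma rep_lin {ι : Type} [Fintype ι] {f : ι → ℂ → ℂ} {N : ι → Measure ℝ}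
    (hf : ∀ k, SS (f k)) (hR : ∀ k, HRep (f k) (N k)) (β : ι → ℂ)
    (h : ∀ z : ℂ, 0 < z.im → ∑ k, β k * f k z = 0)
    (h' : ∀ z : ℂ, 0 < z.im → ∑ k, (starRingEnd ℂ) (β k) * f k z = 0)
    {φ : ℝ → ℂ} (hφ : ∀ k, Integrable φ (N k)) :
    ∑ k, β k * ∫ t, φ t ∂(N k) = 0 := by
  have hre := rep_lin_real hf hR (fun k => (β k).re) (fun z hz => by
    have : ∑ k, ((β k).re : ℂ) * f k z = (1/2) * (∑ k, β k * f k z + ∑ k, (starRingEnd ℂ) (β k) * f k z) := by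
      rw [← Finset.sum_add_distrib, Finset.mul_sum]
      refine Finset.sum_congr rfl fun k _ => ?_
      rw [← add_mul, Complex.add_conj]
      push_cast
      ring
    rw [this, h z hz, h' z hz]; simp) hφ
  have him := rep_lin_real hf hR (fun k => (β k).im) (fun z hz => by
    have : ∑ k, ((β k).im : ℂ) * f k z = (-I/2) * (∑ k, β k * f k z - ∑ k, (starRingEnd ℂ) (β k) * f k z) := by
      rw [← Finset.sum_sub_distrib, Finset.mul_sum]
      refine Finset.sum_congr rfl fun k _ => ?_
      rw [← sub_mul, Complex.sub_conj]
      push_cast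
      linear_combination ((β k).im : ℂ) * f k z * Complex.I_sq
    rw [this, h z hz, h' z hz]; simp) hφ
  have e : ∑ k, β k * ∫ t, φ t ∂(N k) = ∑ k, ((β k).re : ℂ) * ∫ t, φ t ∂(N k)
      + I * ∑ k, ((β k).im : ℂ) * ∫ t, φ t ∂(N k) := by
    rw [Finset.mul_sum, ← Finset.sum_add_distrib]
    refine Finset.sum_congr rfl fun k _ => ?_
    conv_lhs => rw [← Complex.re_add_im (β k)]
    ring
  rw [e, hre, him]
  simp

lemma cc_lin {ι : Type} [Fintype ι] {f : ι → ℂ → ℂ} {N : ι → Measure ℝ}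
    (hf : ∀ k, SS (f k)) (hR : ∀ k, HRep (f k) (N k)) (β : ι → ℂ)
    (h : ∀ z : ℂ, 0 < z.im → ∑ k, β k * f k z = 0)
    (h' : ∀ z : ℂ, 0 < z.im → ∑ k, (starRingEnd ℂ) (β k) * f k z = 0) :
    ∑ k, β k * (cc (f k) (N k) : ℂ) = 0 := by
  have h1 := rep_lin hf hR β h h' (φ := fun t => (t : ℂ)) (fun k => (rep_int (hf k) (hR k)).ofReal)
  have hI : (0:ℝ) < (I : ℂ).im := by simp
  have h2 : ∑ k, β k * ((f k I).re : ℂ) = 0 := by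
    have e : ∑ k, β k * ((f k I).re : ℂ) = (1/2) * (∑ k, β k * f k I
        + (starRingEnd ℂ) (∑ k, (starRingEnd ℂ) (β k) * f k I)) := by
      rw [map_sum, ← Finset.sum_add_distrib, Finset.mul_sum]
      refine Finset.sum_congr rfl fun k _ => ?_
      rw [map_mul, Complex.conj_conj, ← mul_add, Complex.add_conj]
      push_cast
      ring
    rw [e, h I hI, h' I hI]; simp
  have e2 : ∀ k, ∫ t : ℝ, (t : ℂ) ∂(N k) = ((∫ t, t ∂(N k) : ℝ) : ℂ) := fun k => integral_ofReal
  simp only [e2] at h1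
  simp only [cc, Complex.ofReal_sub, mul_sub, Finset.sum_sub_distrib, h1, h2, sub_zero]

/-- versions with a distinguished function -/
lemma opt_lin {ι : Type} [Fintype ι] {f : ι → ℂ → ℂ} {N : ι → Measure ℝ} {g : ℂ → ℂ} {M : Measure ℝ}
    (hf : ∀ k, SS (f k)) (hR : ∀ k, HRep (f k) (N k)) (hg : SS g) (hM : HRep g M) (β : ι → ℂ)
    (h : ∀ z : ℂ, 0 < z.im → g z = ∑ k, β k * f k z)
    (h' : ∀ z : ℂ, 0 < z.im → g z = ∑ k, (starRingEnd ℂ) (β k) * f k z) :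
    (cc g M : ℂ) = ∑ k, β k * (cc (f k) (N k) : ℂ) ∧
    ∀ φ : ℝ → ℂ, (∀ k, Integrable φ (N k)) → Integrable φ M →
      ∫ t, φ t ∂M = ∑ k, β k * ∫ t, φ t ∂(N k) := by
  let f' : Option ι → ℂ → ℂ := fun o => o.elim g f
  let N' : Option ι → Measure ℝ := fun o => o.elim M N
  let β' : Option ι → ℂ := fun o => o.elim (-1) β
  have hf' : ∀ k, SS (f' k) := by rintro (_ | k); exacts [hg, hf k]
  have hR' : ∀ k, HRep (f' k) (N' k) := by rintro (_ | k); exacts [hM, hR k]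
  have k1 : ∀ z : ℂ, 0 < z.im → ∑ k, β' k * f' k z = 0 := by
    intro z hz
    rw [Fintype.sum_option]
    simp only [β', f', Option.elim]
    rw [← h z hz]; ring
  have k2 : ∀ z : ℂ, 0 < z.im → ∑ k, (starRingEnd ℂ) (β' k) * f' k z = 0 := by
    intro z hz
    rw [Fintype.sum_option]
    simp only [β', f', Option.elim, map_neg, map_one]
    rw [← h' z hz]; ring
  constructor
  · have := cc_lin hf' hR' β' k1 k2
    rw [Fintype.sum_option] at this
    simp only [β', f', N', Option.elim] at this
    linear_combination -this
  · intro φ h1 h2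
    have := rep_lin hf' hR' β' k1 k2 (φ := φ) (by rintro (_ | k); exacts [h2, h1 k])
    rw [Fintype.sum_option] at this
    simp only [β', N', Option.elim] at this
    linear_combination -this

/-- quadratic form -/
def quad {n : ℕ} (M : Matrix (Fin n) (Fin n) ℂ) (v : Fin n → ℂ) : ℂ :=
  ∑ i, ∑ j, (starRingEnd ℂ) (v i) * v j * M i j

lemma quad_eq {n : ℕ} (M : Matrix (Fin n) (Fin n) ℂ) (v : Fin n → ℂ) :
    star v ⬝ᵥ (M *ᵥ v) = quad M v := by
  simp only [quad, dotProduct, mulVec, Pi.star_apply, Finset.mul_sum]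
  refine Finset.sum_congr rfl fun i _ => Finset.sum_congr rfl fun j _ => ?_
  rw [Complex.star_def]
  ring

lemma quad_conjTranspose {n : ℕ} (M : Matrix (Fin n) (Fin n) ℂ) (v : Fin n → ℂ) :
    quad Mᴴ v = (starRingEnd ℂ) (quad M v) := by
  simp only [quad, map_sum, map_mul, Complex.conj_conj, conjTranspose_apply, Complex.star_def]
  rw [Finset.sum_comm]
  refine Finset.sum_congr rfl fun i _ => Finset.sum_congr rfl fun j _ => ?_
  ring

lemma quad_cont {n : ℕ} (M : Matrix (Fin n) (Fin n) ℂ) : Continuous (quad M) := by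
  unfold quad
  refine continuous_finsetSum _ fun i _ => continuous_finsetSum _ fun j _ => ?_
  exact ((Complex.continuous_conj.comp (continuous_apply i)).mul (continuous_apply j)).mul continuous_const

/-- polarization vectors -/
def uu {n : ℕ} (p : Fin n × Fin n × Fin 4) : Fin n → ℂ :=
  Pi.single p.1 1 + Pi.single p.2.1 (I ^ (p.2.2 : ℕ))

/-- polarization coefficients -/
def bb (k : Fin 4) : ℂ := (-I) ^ (k : ℕ) / 4

/-- matrix from polarization data -/
def pmat {n : ℕ} (x : Fin n × Fin n × Fin 4 → ℂ) : Matrix (Fin n) (Fin n) ℂ :=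
  Matrix.of fun i j => ∑ k, bb k * x (i, j, k)

/-- coefficients of a quadratic form -/
def ββ {n : ℕ} (v : Fin n → ℂ) (p : Fin n × Fin n × Fin 4) : ℂ :=
  (starRingEnd ℂ) (v p.1) * v p.2.1 * bb p.2.2

lemma quad_pmat {n : ℕ} (x : Fin n × Fin n × Fin 4 → ℂ) (v : Fin n → ℂ) :
    quad (pmat x) v = ∑ p, ββ v p * x p := by
  rw [Fintype.sum_prod_type]
  simp only [Fintype.sum_prod_type, quad, pmat, ββ, Matrix.of_apply, Finset.mul_sum, mul_assoc]

lemma quad_two {n : ℕ} (M : Matrix (Fin n) (Fin n) ℂ) (i j : Fin n) (c : ℂ) :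
    quad M (Pi.single i 1 + Pi.single j c) = M i i + c * M i j + (starRingEnd ℂ) c * M j i
      + (starRingEnd ℂ) c * c * M j j := by
  rw [← quad_eq, star_add, mulVec_add, add_dotProduct, dotProduct_add, dotProduct_add]
  simp only [← Pi.single_star, single_dotProduct, mulVec_single, star_one]
  simp
  ring

lemma polar {n : ℕ} (M : Matrix (Fin n) (Fin n) ℂ) : M = pmat fun p => quad M (uu p) := by
  ext i j
  simp only [pmat, uu, quad_two, Matrix.of_apply, Fin.sum_univ_four, bb]
  simp
  ring_nf
  simp only [Complex.I_sq, show I ^ 3 = -I from Complex.I_pow_three, Complex.I_pow_four,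
    show I ^ 6 = -1 from by rw [show (6:ℕ) = 4 + 2 from rfl, pow_add]; simp,
    show I ^ 5 = I from by rw [show (5:ℕ) = 4 + 1 from rfl, pow_add]; simp,
    show I ^ 9 = I from by rw [show (9:ℕ) = 4 + 4 + 1 from rfl, pow_add, pow_add]; simp,
    show I ^ 8 = 1 from by rw [show (8:ℕ) = 4 + 4 from rfl, pow_add]; simp]
  ring

lemma quad_expand {n : ℕ} (M : Matrix (Fin n) (Fin n) ℂ) (v : Fin n → ℂ) :
    quad M v = ∑ p, ββ v p * quad M (uu p) := by
  conv_lhs => rw [polar M]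
  rw [quad_pmat]

lemma quad_expand' {n : ℕ} (M : Matrix (Fin n) (Fin n) ℂ) (v : Fin n → ℂ) :
    quad M v = ∑ p, (starRingEnd ℂ) (ββ v p) * quad M (uu p) := by
  have h := congrArg (starRingEnd ℂ) (quad_expand Mᴴ v)
  simp only [map_sum, map_mul, quad_conjTranspose, Complex.conj_conj] at h
  exact h

lemma psd_of_quad {n : ℕ} {M : Matrix (Fin n) (Fin n) ℂ} (h : ∀ v, 0 ≤ quad M v) : M.PosSemidef := by
  rw [posSemidef_iff_dotProduct_mulVec]
  refine ⟨?_, fun v => by rw [quad_eq]; exact h v⟩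
  have e : ∀ v, quad Mᴴ v = quad M v := by
    intro v
    rw [quad_conjTranspose]
    have := (Complex.nonneg_iff.1 (h v)).2
    exact Complex.conj_eq_iff_im.2 this.symm
  rw [IsHermitian, polar Mᴴ]
  conv_rhs => rw [polar M]
  simp only [e]

lemma quad_matIm {n : ℕ} (M : Matrix (Fin n) (Fin n) ℂ) (v : Fin n → ℂ) :
    quad (matIm M) v = ((quad M v).im : ℂ) := by
  have e : quad (matIm M) v = (2 * I)⁻¹ * (quad M v - quad Mᴴ v) := by
    simp only [quad, matIm, Finset.mul_sum, ← Finset.sum_sub_distrib, Matrix.smul_apply, Matrix.sub_apply, smul_eq_mul]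
    refine Finset.sum_congr rfl fun i _ => Finset.sum_congr rfl fun j _ => ?_
    ring
  rw [e, quad_conjTranspose, Complex.sub_conj]
  have : (I : ℂ) ≠ 0 := Complex.I_ne_zero
  push_cast
  field_simp

lemma quad_smul {n : ℕ} (a : ℂ) (M : Matrix (Fin n) (Fin n) ℂ) (v : Fin n → ℂ) :
    quad (a • M) v = a * quad M v := by
  simp only [quad, Finset.mul_sum, Matrix.smul_apply, smul_eq_mul]
  refine Finset.sum_congr rfl fun i _ => Finset.sum_congr rfl fun j _ => ?_
  ring

lemma im_of_psd {n : ℕ} {M : Matrix (Fin n) (Fin n) ℂ} (h : (matIm M).PosSemidef) (v : Fin n → ℂ) :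
    0 ≤ (quad M v).im := by
  have := h.dotProduct_mulVec_nonneg v
  rw [quad_eq, quad_matIm] at this
  exact_mod_cast this

lemma ss_quad {n : ℕ} {F : ℂ → Matrix (Fin n) (Fin n) ℂ}
    (hF : ∀ i j, DifferentiableOn ℂ (fun z => F z i j) {z : ℂ | 0 < z.im})
    (h1 : ∀ z : ℂ, 0 < z.im → (matIm (F z)).PosSemidef)
    (h2 : ∀ z : ℂ, 0 < z.im → (matIm (z • F z)).PosSemidef) (v : Fin n → ℂ) :
    SS fun z => quad (F z) v := by
  refine ⟨?_, fun z hz => ⟨im_of_psd (h1 z hz) v, ?_⟩⟩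
  · unfold quad
    refine DifferentiableOn.fun_sum fun i _ => DifferentiableOn.fun_sum fun j _ => ?_
    exact (hF i j).const_mul _
  · have := im_of_psd (h2 z hz) v
    rwa [quad_smul] at this

lemma psd_density {n : ℕ} {F : ℂ → Matrix (Fin n) (Fin n) ℂ} (hS : ∀ v, SS fun z => quad (F z) v)
    {N : Fin n × Fin n × Fin 4 → Measure ℝ} (hN : ∀ p, HRep (fun z => quad (F z) (uu p)) (N p))
    {τ : Measure ℝ} [IsFiniteMeasure τ] (hτ : τ = ∑ p, N p) :
    ∀ᵐ t ∂τ, (pmat fun p => (((N p).rnDeriv τ t).toReal : ℂ)).PosSemidef := by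
  have hfin := fun p => rep_fin (hN p)
  have hac : ∀ p, N p ≪ τ := by
    intro p
    rw [hτ]
    refine Measure.absolutelyContinuous_of_le ?_
    exact Finset.single_le_sum (f := N) (fun _ _ => Measure.zero_le _) (Finset.mem_univ p)
  have hv : ∀ v : Fin n → ℂ, ∀ᵐ t ∂τ, 0 ≤ quad (pmat fun p => (((N p).rnDeriv τ t).toReal : ℂ)) v := by
    intro v
    obtain ⟨Nv, hNv⟩ := rep_exists (hS v)
    have hfv := rep_fin hNv
    have hA : ∀ A : Set ℝ, MeasurableSet A → (Nv.real A : ℂ) = ∑ p, ββ v p * ((N p).real A : ℂ) := by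
      intro A mA
      have h := (opt_lin (fun p => hS (uu p)) hN (hS v) hNv (ββ v)
        (fun z _ => quad_expand (F z) v) (fun z _ => quad_expand' (F z) v)).2
        (A.indicator fun _ => (1:ℂ))
        (fun p => (integrable_const _).indicator mA) ((integrable_const _).indicator mA)
      simp only [integral_indicator_const _ mA] at h
      simpa using h
    have hacv : Nv ≪ τ := by
      refine Measure.AbsolutelyContinuous.mk fun A mA h0 => ?_
      have h := hA A mA
      have : ∀ p, (N p).real A = 0 := fun p => by
        rw [measureReal_eq_zero_iff]; exact hac p h0
      simp only [this, Complex.ofReal_zero, mul_zero, Finset.sum_const_zero] at h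
      rw [← measureReal_eq_zero_iff]
      exact_mod_cast h
    have ig : ∀ p, Integrable (fun t => (((N p).rnDeriv τ t).toReal : ℂ)) τ := fun p =>
      Measure.integrable_toReal_rnDeriv.ofReal
    have igv : Integrable (fun t => ((Nv.rnDeriv τ t).toReal : ℂ)) τ :=
      Measure.integrable_toReal_rnDeriv.ofReal
    have is : Integrable (fun t => ∑ p, ββ v p * (((N p).rnDeriv τ t).toReal : ℂ)) τ :=
      integrable_finsetSum _ fun p _ => (ig p).const_mul _
    have key : (fun t => ∑ p, ββ v p * (((N p).rnDeriv τ t).toReal : ℂ)) =ᵐ[τ]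
        fun t => ((Nv.rnDeriv τ t).toReal : ℂ) := by
      refine is.ae_eq_of_forall_setIntegral_eq _ _ igv fun A mA _ => ?_
      rw [integral_finsetSum _ fun p _ => ((ig p).const_mul _).integrableOn]
      have e : ∀ M : Measure ℝ, IsFiniteMeasure M → M ≪ τ →
          ∫ t in A, ((M.rnDeriv τ t).toReal : ℂ) ∂τ = (M.real A : ℂ) := by
        intro M _ hM
        rw [← Measure.setIntegral_toReal_rnDeriv hM]
        exact integral_ofReal
      rw [e Nv hfv hacv, hA A mA]
      refine Finset.sum_congr rfl fun p _ => ?_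
      rw [integral_const_mul, e (N p) (hfin p) (hac p)]
    filter_upwards [key] with t ht
    rw [quad_pmat, ht]
    exact_mod_cast ENNReal.toReal_nonneg
  have hall := ae_all_iff.2 fun m : ℕ => hv (TopologicalSpace.denseSeq (Fin n → ℂ) m)
  filter_upwards [hall] with t ht
  refine psd_of_quad fun v => ?_
  have hcl : IsClosed {v | 0 ≤ quad (pmat fun p => (((N p).rnDeriv τ t).toReal : ℂ)) v} :=
    isClosed_Ici.preimage (quad_cont _)
  have hd := TopologicalSpace.denseRange_denseSeq (Fin n → ℂ)
  exact hd.induction_on (p := fun v => 0 ≤ quad (pmat fun p => (((N p).rnDeriv τ t).toReal : ℂ)) v) v hcl ht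

lemma aux_int {f : ℂ → ℂ} (hf : SS f) {N : Measure ℝ} (h : HRep f N) :
    Integrable (fun t : ℝ => (1 + (t : ℂ))⁻¹ * (1 + (t : ℂ) ^ 2)) N := by
  have := rep_fin h
  have mr : Measurable fun t : ℝ => (t : ℂ) := Complex.measurable_ofReal
  refine Integrable.mono' ((integrable_const 1).add (rep_int hf h))
    ((measurable_const.add mr).inv.mul (measurable_const.add (mr.pow_const 2))).aestronglyMeasurable ?_
  have h0 : ∀ᵐ t ∂N, t ∉ Set.Iio (0:ℝ) := measure_eq_zero_iff_ae_notMem.1 (rep_neg hf h)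
  filter_upwards [h0] with t ht
  have ht : 0 ≤ t := by simpa using ht
  have e : (1 + (t : ℂ))⁻¹ * (1 + (t : ℂ) ^ 2) = (((1 + t)⁻¹ * (1 + t ^ 2) : ℝ) : ℂ) := by push_cast; rfl
  rw [e, Complex.norm_real, Real.norm_eq_abs, abs_of_nonneg (by positivity)]
  rw [inv_mul_le_iff₀ (by positivity)]
  simp only [Pi.add_apply]
  nlinarith

/-- Theorem A.6 (Proposition 2.2 part 3): a matrix-valued function `F`, analytic on
`ℂ⁺` and such that `Im F(z) ≥ 0` and `Im (zF(z)) ≥ 0` there, can be written as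
`F(z) = C + ∫_{ℝ₊} (t - z)⁻¹ μ(dt)` where `C ≥ 0` and `μ` is a positive matrix-valued
measure carried by `ℝ₊` with `Tr ∫ (1+t)⁻¹ μ(dt) < ∞`.  The positive matrix-valued
measure is encoded by a (σ-finite) trace measure `τ` together with an a.e. positive
semidefinite matrix density `ρ`. -/
theorem stmt_11 (n : ℕ) (F : ℂ → Matrix (Fin n) (Fin n) ℂ)
    (hF : ∀ i j, DifferentiableOn ℂ (fun z => F z i j) {z : ℂ | 0 < z.im})
    (h1 : ∀ z : ℂ, 0 < z.im → (matIm (F z)).PosSemidef)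
    (h2 : ∀ z : ℂ, 0 < z.im → (matIm (z • F z)).PosSemidef) :
    ∃ C : Matrix (Fin n) (Fin n) ℂ, C.PosSemidef ∧
      ∃ (τ : Measure ℝ) (ρ : ℝ → Matrix (Fin n) (Fin n) ℂ),
        τ (Set.Iio 0) = 0
        ∧ (∀ i j, Measurable fun t : ℝ => ρ t i j)
        ∧ (∀ᵐ t ∂τ, (ρ t).PosSemidef)
        ∧ (∀ i, Integrable (fun t : ℝ => (1 + (t : ℂ))⁻¹ * ρ t i i) τ)
        ∧ ∀ z : ℂ, 0 < z.im →
            (∀ i j, Integrable (fun t : ℝ => ((t : ℂ) - z)⁻¹ * ρ t i j) τ)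
            ∧ F z = C + Matrix.of fun i j => ∫ t, ((t : ℂ) - z)⁻¹ * ρ t i j ∂τ := by
  have hS := ss_quad hF h1 h2
  choose N hN using fun p : Fin n × Fin n × Fin 4 => rep_exists (hS (uu p))
  have hfin := fun p => rep_fin (hN p)
  set τ : Measure ℝ := ∑ p, N p with hτ
  have hac : ∀ p, N p ≪ τ := by
    intro p
    rw [hτ]
    refine Measure.absolutelyContinuous_of_le ?_
    exact Finset.single_le_sum (f := N) (fun _ _ => Measure.zero_le _) (Finset.mem_univ p)
  have psd := psd_density hS hN hτ
  have expand : ∀ (φ : ℝ → ℂ) (i j : Fin n) (t : ℝ),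
      φ t * (((1 + (t : ℂ) ^ 2)) * (pmat fun p => (((N p).rnDeriv τ t).toReal : ℂ)) i j) =
      ∑ k, bb k * (((N (i, j, k)).rnDeriv τ t).toReal • (φ t * (1 + (t : ℂ) ^ 2))) := by
    intro φ i j t
    simp only [pmat, Matrix.of_apply, Finset.mul_sum, Complex.real_smul]
    refine Finset.sum_congr rfl fun k _ => ?_
    ring
  have intg : ∀ (φ : ℝ → ℂ), (∀ p, Integrable (fun t : ℝ => φ t * (1 + (t : ℂ) ^ 2)) (N p)) →
      ∀ i j, Integrable (fun t : ℝ => φ t * (((1 + (t : ℂ) ^ 2)) *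
        (pmat fun p => (((N p).rnDeriv τ t).toReal : ℂ)) i j)) τ ∧
      ∫ t : ℝ, φ t * (((1 + (t : ℂ) ^ 2)) *
        (pmat fun p => (((N p).rnDeriv τ t).toReal : ℂ)) i j) ∂τ
        = ∑ k, bb k * ∫ t : ℝ, φ t * (1 + (t : ℂ) ^ 2) ∂(N (i, j, k)) := by
    intro φ hφ i j
    have a : ∀ k, Integrable (fun t : ℝ => bb k * (((N (i, j, k)).rnDeriv τ t).toReal •
        (φ t * (1 + (t : ℂ) ^ 2)))) τ := fun k =>
      ((integrable_rnDeriv_smul_iff (hac (i, j, k))).2 (hφ _)).const_mul _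
    simp only [expand]
    refine ⟨integrable_finsetSum _ fun k _ => a k, ?_⟩
    rw [integral_finsetSum _ fun k _ => a k]
    refine Finset.sum_congr rfl fun k _ => ?_
    rw [integral_const_mul, integral_rnDeriv_smul (hac (i, j, k))]
  refine ⟨pmat fun p => (cc (fun z => quad (F z) (uu p)) (N p) : ℂ), ?_, τ,
    fun t => (1 + (t : ℂ) ^ 2) • pmat fun p => (((N p).rnDeriv τ t).toReal : ℂ), ?_, ?_, ?_, ?_, ?_⟩
  · refine psd_of_quad fun v => ?_
    rw [quad_pmat]
    obtain ⟨Nv, hNv⟩ := rep_exists (hS v)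
    have h := (opt_lin (fun p => hS (uu p)) hN (hS v) hNv (ββ v)
        (fun z _ => quad_expand (F z) v) (fun z _ => quad_expand' (F z) v)).1
    rw [← h]
    exact_mod_cast rep_cc (hS v) hNv
  · rw [hτ, Measure.coe_finsetSum, Finset.sum_apply]
    exact Finset.sum_eq_zero fun p _ => rep_neg (hS _) (hN p)
  · intro i j
    have mr : Measurable fun t : ℝ => (t : ℂ) := Complex.measurable_ofReal
    simp only [Matrix.smul_apply, pmat, Matrix.of_apply, smul_eq_mul]
    refine (measurable_const.add (mr.pow_const 2)).mul (Finset.measurable_fun_sum _ fun k _ => ?_)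
    exact (Complex.measurable_ofReal.comp (Measure.measurable_rnDeriv _ _).ennreal_toReal).const_mul _
  · filter_upwards [psd] with t ht
    refine psd_of_quad fun v => ?_
    rw [quad_smul]
    refine mul_nonneg ?_ (by rw [← quad_eq]; exact ht.dotProduct_mulVec_nonneg v)
    have : (0:ℝ) ≤ 1 + t ^ 2 := by positivity
    exact_mod_cast this
  · intro i
    exact (intg _ (fun p => aux_int (hS _) (hN p)) i i).1
  · intro z hz
    have hI : ∀ p, Integrable (fun t : ℝ => ((t : ℂ) - z)⁻¹ * (1 + (t : ℂ) ^ 2)) (N p) := by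
      intro p
      refine (rep_eq (hS _) (hN p) hz).1.congr (ae_of_all _ fun t => ?_)
      change (1 + (t : ℂ) ^ 2) / ((t : ℂ) - z) = _
      rw [div_eq_mul_inv, mul_comm]
    refine ⟨fun i j => (intg _ hI i j).1, ?_⟩
    ext i j
    simp only [Matrix.add_apply, Matrix.of_apply, Matrix.smul_apply, smul_eq_mul]
    rw [(intg _ hI i j).2]
    conv_lhs => rw [polar (F z)]
    simp only [pmat, Matrix.of_apply]
    rw [← Finset.sum_add_distrib]
    refine Finset.sum_congr rfl fun k _ => ?_
    rw [← mul_add]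
    congr 1
    have := (rep_eq (hS _) (hN (i, j, k)) hz).2
    simp only [div_eq_inv_mul] at this
    exact this
end
end

section
/- Let P_n be the empirical distribution of the eigenvalues of Σ_nΣ_nᵀ and π_n the probability measure on ℝ+ whose Stieltjes transform is (1/N)Tr T_n. Then E∫_{[0,∞)} λ P_n(dλ) = ∫_{[0,∞)} λ π_n(dλ) = (1/(Nn)) Σ_{i=1}^{N} Σ_{j=1}^{n} σ_ij² + (1/N)Tr(A_nA_nᵀ). In particular, sup_n E∫λ P_n(dλ) = sup_n ∫λ π_n(dλ) ≤ σ_max² + a_max². -/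
open MeasureTheory Matrix Complex Filter
open scoped Topology ComplexOrder

noncomputable section

/-- The set `ℂ ∖ ℝ₊`. -/
def offRplus : Set ℂ := {z : ℂ | ¬ (z.im = 0 ∧ 0 ≤ z.re)}

/-- `f` is the Stieltjes transform of a probability measure carried by `ℝ₊`. -/
def IsStieltjesPM (f : ℂ → ℂ) : Prop :=
  ∃ μ : Measure ℝ, IsProbabilityMeasure μ ∧ μ (Set.Iio 0) = 0 ∧
    ∀ z ∈ offRplus, f z = ∫ t, ((t : ℂ) - z)⁻¹ ∂μ
def Tmat {N n : ℕ} (A : Matrix (Fin N) (Fin n) ℝ)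
    (ψ : Fin N → ℂ → ℂ) (ψt : Fin n → ℂ → ℂ) (z : ℂ) : Matrix (Fin N) (Fin N) ℂ :=
  ((Matrix.diagonal fun i => ψ i z)⁻¹
    - z • (A.map Complex.ofReal * Matrix.diagonal (fun j => ψt j z) * (A.map Complex.ofReal)ᵀ))⁻¹

def Ttmat {N n : ℕ} (A : Matrix (Fin N) (Fin n) ℝ)
    (ψ : Fin N → ℂ → ℂ) (ψt : Fin n → ℂ → ℂ) (z : ℂ) : Matrix (Fin n) (Fin n) ℂ :=
  ((Matrix.diagonal fun j => ψt j z)⁻¹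
    - z • ((A.map Complex.ofReal)ᵀ * Matrix.diagonal (fun i => ψ i z) * A.map Complex.ofReal))⁻¹

def SolvesSystem {N n : ℕ} (σ : Fin N → Fin n → ℝ) (A : Matrix (Fin N) (Fin n) ℝ)
    (ψ : Fin N → ℂ → ℂ) (ψt : Fin n → ℂ → ℂ) : Prop :=
  (∀ i, IsStieltjesPM (ψ i)) ∧ (∀ j, IsStieltjesPM (ψt j)) ∧
  ∀ z ∈ offRplus,
    (∀ i, ψ i z
      = -(z * (1 + (n : ℂ)⁻¹
          * ((Matrix.diagonal fun j => ((σ i j : ℂ))^2) * Ttmat A ψ ψt z).trace))⁻¹) ∧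
    (∀ j, ψt j z
      = -(z * (1 + (n : ℂ)⁻¹
          * ((Matrix.diagonal fun i => ((σ i j : ℂ))^2) * Tmat A ψ ψt z).trace))⁻¹)
def Sigma_mat {N n : ℕ} (σ : Fin N → Fin n → ℝ) (A : Matrix (Fin N) (Fin n) ℝ)
    (Xv : Fin N → Fin n → ℝ) : Matrix (Fin N) (Fin n) ℝ :=
  Matrix.of fun i j => σ i j * Xv i j / Real.sqrt n + A i j

def Qmat {N n : ℕ} (σ : Fin N → Fin n → ℝ) (A : Matrix (Fin N) (Fin n) ℝ)
    (Xv : Fin N → Fin n → ℝ) (z : ℂ) : Matrix (Fin N) (Fin N) ℂ :=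
  ((Sigma_mat σ A Xv).map Complex.ofReal * ((Sigma_mat σ A Xv).map Complex.ofReal)ᵀ - z • 1)⁻¹

def Qtmat {N n : ℕ} (σ : Fin N → Fin n → ℝ) (A : Matrix (Fin N) (Fin n) ℝ)
    (Xv : Fin N → Fin n → ℝ) (z : ℂ) : Matrix (Fin n) (Fin n) ℂ :=
  (((Sigma_mat σ A Xv).map Complex.ofReal)ᵀ * (Sigma_mat σ A Xv).map Complex.ofReal - z • 1)⁻¹

def bfun {N n : ℕ} (σ : Fin N → Fin n → ℝ) (A : Matrix (Fin N) (Fin n) ℝ)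
    (Xv : Fin N → Fin n → ℝ) (z : ℂ) (i : Fin N) : ℂ :=
  -(z * (1 + (n : ℂ)⁻¹ * ((Matrix.diagonal fun j => ((σ i j : ℂ))^2) * Qtmat σ A Xv z).trace))⁻¹

def btfun {N n : ℕ} (σ : Fin N → Fin n → ℝ) (A : Matrix (Fin N) (Fin n) ℝ)
    (Xv : Fin N → Fin n → ℝ) (z : ℂ) (j : Fin n) : ℂ :=
  -(z * (1 + (n : ℂ)⁻¹ * ((Matrix.diagonal fun i => ((σ i j : ℂ))^2) * Qmat σ A Xv z).trace))⁻¹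

def Rmat {N n : ℕ} (σ : Fin N → Fin n → ℝ) (A : Matrix (Fin N) (Fin n) ℝ)
    (Xv : Fin N → Fin n → ℝ) (z : ℂ) : Matrix (Fin N) (Fin N) ℂ :=
  ((Matrix.diagonal (bfun σ A Xv z))⁻¹
    - z • (A.map Complex.ofReal * Matrix.diagonal (btfun σ A Xv z) * (A.map Complex.ofReal)ᵀ))⁻¹

def Rtmat {N n : ℕ} (σ : Fin N → Fin n → ℝ) (A : Matrix (Fin N) (Fin n) ℝ)
    (Xv : Fin N → Fin n → ℝ) (z : ℂ) : Matrix (Fin n) (Fin n) ℂ :=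
  ((Matrix.diagonal (btfun σ A Xv z))⁻¹
    - z • ((A.map Complex.ofReal)ᵀ * Matrix.diagonal (bfun σ A Xv z) * A.map Complex.ofReal))⁻¹

def yvec {N n : ℕ} (σ : Fin N → Fin n → ℝ) (Xv : Fin N → Fin n → ℝ) (j : Fin n) :
    Fin N → ℂ := fun i => ((σ i j * Xv i j / Real.sqrt n : ℝ) : ℂ)

def avec {N n : ℕ} (A : Matrix (Fin N) (Fin n) ℝ) (j : Fin n) : Fin N → ℂ :=
  fun i => ((A i j : ℝ) : ℂ)

def xivec {N n : ℕ} (σ : Fin N → Fin n → ℝ) (A : Matrix (Fin N) (Fin n) ℝ)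
    (Xv : Fin N → Fin n → ℝ) (j : Fin n) : Fin N → ℂ :=
  fun i => yvec σ Xv j i + avec A j i

def Qjmat {N n : ℕ} (σ : Fin N → Fin n → ℝ) (A : Matrix (Fin N) (Fin n) ℝ)
    (Xv : Fin N → Fin n → ℝ) (j : Fin n) (z : ℂ) : Matrix (Fin N) (Fin N) ℂ :=
  ((Sigma_mat σ A Xv).map Complex.ofReal * ((Sigma_mat σ A Xv).map Complex.ofReal)ᵀ
    - Matrix.vecMulVec (xivec σ A Xv j) (xivec σ A Xv j) - z • 1)⁻¹

def alphaJ {N n : ℕ} (σ : Fin N → Fin n → ℝ) (A : Matrix (Fin N) (Fin n) ℝ)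
    (Xv : Fin N → Fin n → ℝ) (z : ℂ) (j : Fin n) : ℂ :=
  1 + xivec σ A Xv j ⬝ᵥ (Qjmat σ A Xv j z *ᵥ xivec σ A Xv j)

def rhoJ {N n : ℕ} (σ : Fin N → Fin n → ℝ) (A : Matrix (Fin N) (Fin n) ℝ)
    (Xv : Fin N → Fin n → ℝ) (z : ℂ) (j : Fin n) : ℂ :=
  avec A j ⬝ᵥ (Qjmat σ A Xv j z *ᵥ avec A j)

def omegaJ {N n : ℕ} (σ : Fin N → Fin n → ℝ) (A : Matrix (Fin N) (Fin n) ℝ)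
    (Xv : Fin N → Fin n → ℝ) (z : ℂ) (j : Fin n) : ℂ :=
  yvec σ Xv j ⬝ᵥ (Qjmat σ A Xv j z *ᵥ yvec σ Xv j)

def betaJ {N n : ℕ} (σ : Fin N → Fin n → ℝ) (A : Matrix (Fin N) (Fin n) ℝ)
    (Xv : Fin N → Fin n → ℝ) (z : ℂ) (j : Fin n) : ℂ :=
  avec A j ⬝ᵥ (Qjmat σ A Xv j z *ᵥ yvec σ Xv j)

def RUQj {N n : ℕ} (σ : Fin N → Fin n → ℝ) (A : Matrix (Fin N) (Fin n) ℝ)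
    (Xv : Fin N → Fin n → ℝ) (u : Fin N → ℂ) (z : ℂ) (j : Fin n) :
    Matrix (Fin N) (Fin N) ℂ :=
  Rmat σ A Xv z * Matrix.diagonal u * Qjmat σ A Xv j z

def rhoHatJ {N n : ℕ} (σ : Fin N → Fin n → ℝ) (A : Matrix (Fin N) (Fin n) ℝ)
    (Xv : Fin N → Fin n → ℝ) (u : Fin N → ℂ) (z : ℂ) (j : Fin n) : ℂ :=
  avec A j ⬝ᵥ (RUQj σ A Xv u z j *ᵥ avec A j)

def omegaHatJ {N n : ℕ} (σ : Fin N → Fin n → ℝ) (A : Matrix (Fin N) (Fin n) ℝ)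
    (Xv : Fin N → Fin n → ℝ) (u : Fin N → ℂ) (z : ℂ) (j : Fin n) : ℂ :=
  yvec σ Xv j ⬝ᵥ (RUQj σ A Xv u z j *ᵥ yvec σ Xv j)

def betaHatJ {N n : ℕ} (σ : Fin N → Fin n → ℝ) (A : Matrix (Fin N) (Fin n) ℝ)
    (Xv : Fin N → Fin n → ℝ) (u : Fin N → ℂ) (z : ℂ) (j : Fin n) : ℂ :=
  avec A j ⬝ᵥ (RUQj σ A Xv u z j *ᵥ yvec σ Xv j)

def gammaHatJ {N n : ℕ} (σ : Fin N → Fin n → ℝ) (A : Matrix (Fin N) (Fin n) ℝ)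
    (Xv : Fin N → Fin n → ℝ) (u : Fin N → ℂ) (z : ℂ) (j : Fin n) : ℂ :=
  yvec σ Xv j ⬝ᵥ (RUQj σ A Xv u z j *ᵥ avec A j)

def Z1 {N n : ℕ} (σ : Fin N → Fin n → ℝ) (A : Matrix (Fin N) (Fin n) ℝ)
    (Xv : Fin N → Fin n → ℝ) (u : Fin N → ℂ) (z : ℂ) : ℂ :=
  (N : ℂ)⁻¹ * ∑ j, gammaHatJ σ A Xv u z j / alphaJ σ A Xv z j

def Z2 {N n : ℕ} (σ : Fin N → Fin n → ℝ) (A : Matrix (Fin N) (Fin n) ℝ)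
    (Xv : Fin N → Fin n → ℝ) (u : Fin N → ℂ) (z : ℂ) : ℂ :=
  (N : ℂ)⁻¹ * ∑ j, betaHatJ σ A Xv u z j / alphaJ σ A Xv z j
    * (1 - z * btfun σ A Xv z j * (rhoJ σ A Xv z j + betaJ σ A Xv z j))

def Z3 {N n : ℕ} (σ : Fin N → Fin n → ℝ) (A : Matrix (Fin N) (Fin n) ℝ)
    (Xv : Fin N → Fin n → ℝ) (u : Fin N → ℂ) (z : ℂ) : ℂ :=
  (N : ℂ)⁻¹ * ∑ j, rhoHatJ σ A Xv u z j / alphaJ σ A Xv z j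
    * (z * btfun σ A Xv z j * betaJ σ A Xv z j)

def Z4 {N n : ℕ} (σ : Fin N → Fin n → ℝ) (A : Matrix (Fin N) (Fin n) ℝ)
    (Xv : Fin N → Fin n → ℝ) (u : Fin N → ℂ) (z : ℂ) : ℂ :=
  (N : ℂ)⁻¹ * ∑ j, rhoHatJ σ A Xv u z j / alphaJ σ A Xv z j
    * (1 + z * btfun σ A Xv z j * (1 + omegaJ σ A Xv z j))

def Z5 {N n : ℕ} (σ : Fin N → Fin n → ℝ) (A : Matrix (Fin N) (Fin n) ℝ)
    (Xv : Fin N → Fin n → ℝ) (u : Fin N → ℂ) (z : ℂ) : ℂ :=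
  (N : ℂ)⁻¹ * ∑ j, omegaHatJ σ A Xv u z j / alphaJ σ A Xv z j
    - (N : ℂ)⁻¹ * (((Matrix.diagonal (bfun σ A Xv z))⁻¹ + z • 1)
        * Rmat σ A Xv z * Matrix.diagonal u * Qmat σ A Xv z).trace

lemma aux_mem_off {y : ℝ} (hy : 0 < y) : (-(y : ℂ)) ∈ offRplus := by
  simp only [offRplus, Set.mem_ofPred_eq, not_and, not_le]
  intro _
  simpa using hy

lemma aux_int_eq (μ : Measure ℝ) (y : ℝ) :
    (∫ t, ((t : ℂ) - (-(y : ℂ)))⁻¹ ∂μ) = ((∫ t, (t + y)⁻¹ ∂μ : ℝ) : ℂ) := by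
  have h : ((∫ t, (t + y)⁻¹ ∂μ : ℝ) : ℂ) = ∫ t, (((t + y)⁻¹ : ℝ) : ℂ) ∂μ :=
    integral_complex_ofReal.symm
  rw [h]
  congr 1
  funext t
  push_cast
  rw [sub_neg_eq_add]

lemma aux_ae_nonneg (μ : Measure ℝ) (hs : μ (Set.Iio 0) = 0) : ∀ᵐ t ∂μ, 0 ≤ t := by
  rw [ae_iff]
  convert hs using 2
  ext t
  simp

lemma aux_integrable (μ : Measure ℝ) [IsProbabilityMeasure μ] (hs : μ (Set.Iio 0) = 0)
    {y : ℝ} (hy : 0 < y) : Integrable (fun t : ℝ => (t + y)⁻¹) μ := by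
  refine Integrable.of_bound (C := y⁻¹) (by fun_prop : Measurable _).aestronglyMeasurable ?_
  filter_upwards [aux_ae_nonneg μ hs] with t ht
  rw [Real.norm_of_nonneg (by positivity)]
  gcongr
  linarith

lemma aux_moment (μ : Measure ℝ) [IsProbabilityMeasure μ] (hs : μ (Set.Iio 0) = 0) (L : ℝ)
    (h : Tendsto (fun y : ℝ => (y : ℂ) - (y : ℂ)^2 * ∫ t, ((t : ℂ) - (-(y : ℂ)))⁻¹ ∂μ)
      atTop (𝓝 (L : ℂ))) : ∫ t, t ∂μ = L := by
  have hnn := aux_ae_nonneg μ hs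
  have h1 : Tendsto (fun y : ℝ => y - y^2 * ∫ t, (t + y)⁻¹ ∂μ) atTop (𝓝 L) := by
    have := (Complex.continuous_re.tendsto _).comp h
    simp only [Complex.ofReal_re] at this
    refine this.congr fun y => ?_
    simp only [Function.comp, aux_int_eq]
    norm_cast
  have hk : Tendsto (fun k : ℕ => (k : ℝ) + 1) atTop atTop :=
    tendsto_atTop_add_const_right _ _ tendsto_natCast_atTop_atTop
  have h2 := h1.comp hk
  have key : ∀ t y : ℝ, 0 ≤ t → 0 < y → y - y^2 * (t + y)⁻¹ = y * t / (t + y) := by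
    intro t y ht hy
    have : t + y ≠ 0 := by positivity
    field_simp
    ring
  have hI : ∀ y : ℝ, 0 < y → ∫ t, (y - y^2 * (t + y)⁻¹) ∂μ = y - y^2 * ∫ t, (t + y)⁻¹ ∂μ := by
    intro y hy
    rw [integral_sub (integrable_const _) ((aux_integrable μ hs hy).const_mul _),
      integral_const_mul]
    simp
  have hpos : ∀ y : ℝ, 0 < y → ∀ᵐ t ∂μ, 0 ≤ y - y^2 * (t + y)⁻¹ := by
    intro y hy
    filter_upwards [hnn] with t ht
    rw [key t y ht hy]
    positivity
  have h3 : Tendsto (fun k : ℕ => ∫⁻ t, ENNReal.ofReal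
      (((k:ℝ)+1) - ((k:ℝ)+1)^2 * (t + ((k:ℝ)+1))⁻¹) ∂μ) atTop
      (𝓝 (∫⁻ t, ENNReal.ofReal t ∂μ)) := by
    refine lintegral_tendsto_of_tendsto_of_monotone (fun k => ?_) ?_ ?_
    · exact (by fun_prop : Measurable _).aemeasurable
    · filter_upwards [hnn] with t ht
      intro a b hab
      apply ENNReal.ofReal_le_ofReal
      have ha : (a : ℝ) ≤ b := by exact_mod_cast hab
      rw [key t _ ht (by positivity), key t _ ht (by positivity),
        div_le_div_iff₀ (by positivity) (by positivity)]
      nlinarith [mul_nonneg (mul_nonneg ht ht) (sub_nonneg.2 ha)]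
    · filter_upwards [hnn] with t ht
      refine (ENNReal.continuous_ofReal.tendsto _).comp ?_
      have : Tendsto (fun y : ℝ => t - t^2 * (t + y)⁻¹) atTop (𝓝 (t - t^2 * 0)) := by
        refine tendsto_const_nhds.sub (Tendsto.const_mul _ ?_)
        exact tendsto_inv_atTop_zero.comp (tendsto_atTop_add_const_left _ _ tendsto_id)
      rw [mul_zero, sub_zero] at this
      refine (this.comp hk).congr fun k => ?_
      have : t + ((k:ℝ)+1) ≠ 0 := by positivity
      simp only [Function.comp]
      field_simp
      ring
  have h4 : Tendsto (fun k : ℕ => ∫⁻ t, ENNReal.ofReal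
      (((k:ℝ)+1) - ((k:ℝ)+1)^2 * (t + ((k:ℝ)+1))⁻¹) ∂μ) atTop
      (𝓝 (ENNReal.ofReal L)) := by
    refine ((ENNReal.continuous_ofReal.tendsto _).comp h2).congr fun k => ?_
    have hy : (0:ℝ) < (k:ℝ)+1 := by positivity
    simp only [Function.comp]
    rw [← hI _ hy, ofReal_integral_eq_lintegral_ofReal _ (hpos _ hy)]
    exact (integrable_const _).sub ((aux_integrable μ hs hy).const_mul _)
  have h5 := tendsto_nhds_unique h3 h4
  have hL : 0 ≤ L := by
    refine ge_of_tendsto' h2 fun k => ?_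
    have hy : (0:ℝ) < (k:ℝ)+1 := by positivity
    simp only [Function.comp]
    rw [← hI _ hy]
    exact integral_nonneg_of_ae (hpos _ hy)
  rw [integral_eq_lintegral_of_nonneg_ae hnn measurable_id.aestronglyMeasurable, h5,
    ENNReal.toReal_ofReal hL]

lemma aux_stieltjes {f : ℂ → ℂ} (hf : IsStieltjesPM f) :
    Tendsto (fun y : ℝ => (y : ℂ) * f (-(y : ℂ))) atTop (𝓝 1) := by
  obtain ⟨μ, hμ, hs, hf⟩ := hf
  have hnn := aux_ae_nonneg μ hs
  have h1 : Tendsto (fun y : ℝ => ∫ t, y * (t + y)⁻¹ ∂μ) atTop (𝓝 (∫ _t : ℝ, (1:ℝ) ∂μ)) := by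
    refine tendsto_integral_filter_of_dominated_convergence (fun _ => (1:ℝ)) ?_ ?_
      (integrable_const _) ?_
    · exact Eventually.of_forall fun y => (by fun_prop : Measurable _).aestronglyMeasurable
    · filter_upwards [eventually_gt_atTop 0] with y hy
      filter_upwards [hnn] with t ht
      rw [Real.norm_of_nonneg (by positivity), ← div_eq_mul_inv, div_le_one (by positivity)]
      linarith
    · filter_upwards [hnn] with t ht
      have : Tendsto (fun y : ℝ => 1 - t * (t + y)⁻¹) atTop (𝓝 (1 - t * 0)) := by
        refine tendsto_const_nhds.sub (Tendsto.const_mul _ ?_)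
        exact tendsto_inv_atTop_zero.comp (tendsto_atTop_add_const_left _ _ tendsto_id)
      rw [mul_zero, sub_zero] at this
      refine this.congr' ?_
      filter_upwards [eventually_gt_atTop 0] with y hy
      have : t + y ≠ 0 := by positivity
      field_simp
      ring
  simp only [integral_const, probReal_univ, smul_eq_mul, mul_one] at h1
  have h2 := (Complex.continuous_ofReal.tendsto _).comp h1
  rw [Complex.ofReal_one] at h2
  refine h2.congr' ?_
  filter_upwards [eventually_gt_atTop 0] with y hy
  rw [hf _ (aux_mem_off hy), aux_int_eq, Function.comp, integral_const_mul]
  push_cast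
  rfl

lemma aux_inv {m : ℕ} {C : ℝ → Matrix (Fin m) (Fin m) ℂ} (h : Tendsto C atTop (𝓝 1)) :
    Tendsto (fun y => (C y)⁻¹) atTop (𝓝 1) ∧ ∀ᶠ y in atTop, IsUnit (C y).det := by
  have hd : Tendsto (fun y => (C y).det) atTop (𝓝 1) := by
    have : Continuous fun M : Matrix (Fin m) (Fin m) ℂ => M.det := continuous_id.matrix_det
    simpa [Function.comp_def] using (this.tendsto 1).comp h
  have ha : Tendsto (fun y => (C y).adjugate) atTop (𝓝 1) := by
    have : Continuous fun M : Matrix (Fin m) (Fin m) ℂ => M.adjugate :=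
      continuous_id.matrix_adjugate
    simpa [Function.comp_def] using (this.tendsto 1).comp h
  constructor
  · have := (hd.inv₀ one_ne_zero).smul ha
    simp only [inv_one, one_smul] at this
    refine this.congr fun y => ?_
    rw [Matrix.inv_def, Ring.inverse_eq_inv']
  · filter_upwards [hd.eventually_ne one_ne_zero] with y hy
    exact isUnit_iff_ne_zero.2 hy

lemma aux_cinv : Tendsto (fun y : ℝ => ((y : ℂ))⁻¹) atTop (𝓝 0) := by
  have := (Complex.continuous_ofReal.tendsto _).comp tendsto_inv_atTop_zero
  simpa [Function.comp_def] using this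

lemma aux_resolvent {N : ℕ} (hN : 0 < N) {B : ℝ → Matrix (Fin N) (Fin N) ℂ}
    {B0 : Matrix (Fin N) (Fin N) ℂ} (h : Tendsto B atTop (𝓝 B0)) :
    Tendsto (fun y : ℝ => (y : ℂ) - (y : ℂ)^2 *
      ((N : ℂ)⁻¹ * ((y : ℂ) • (1 : Matrix (Fin N) (Fin N) ℂ) + B y)⁻¹.trace)) atTop
      (𝓝 ((N : ℂ)⁻¹ * B0.trace)) := by
  have hC : Tendsto (fun y : ℝ => (1 : Matrix (Fin N) (Fin N) ℂ) + ((y : ℂ))⁻¹ • B y)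
      atTop (𝓝 1) := by
    simpa using tendsto_const_nhds.add (aux_cinv.smul h)
  obtain ⟨h1, h2⟩ := aux_inv hC
  have h3 := h1.mul h
  rw [one_mul] at h3
  have ht : Continuous fun M : Matrix (Fin N) (Fin N) ℂ => M.trace := continuous_id.matrix_trace
  refine (((ht.tendsto _).comp h3).const_mul ((N : ℂ)⁻¹)).congr' ?_
  filter_upwards [h2, eventually_gt_atTop 0] with y hu hy
  have hy' : (y : ℂ) ≠ 0 := by exact_mod_cast hy.ne'
  have hN' : (N : ℂ) ≠ 0 := by exact_mod_cast hN.ne'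
  set C := (1 : Matrix (Fin N) (Fin N) ℂ) + ((y : ℂ))⁻¹ • B y with hCdef
  have e1 : (y : ℂ) • (1 : Matrix (Fin N) (Fin N) ℂ) + B y = (y : ℂ) • C := by
    rw [hCdef, smul_add, smul_smul, mul_inv_cancel₀ hy', one_smul]
  have e2 : ((y : ℂ) • C)⁻¹ = (y : ℂ)⁻¹ • C⁻¹ := by
    apply Matrix.inv_eq_right_inv
    rw [smul_mul_smul_comm, mul_inv_cancel₀ hy', one_smul, Matrix.mul_nonsing_inv _ hu]
  have e3 : B y = (y : ℂ) • C - (y : ℂ) • 1 := by rw [← e1]; abel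
  have e4 : C⁻¹ * B y = (y : ℂ) • 1 - (y : ℂ) • C⁻¹ := by
    rw [e3, Matrix.mul_sub, Matrix.mul_smul, Matrix.mul_smul, Matrix.nonsing_inv_mul _ hu,
      Matrix.mul_one]
  simp only [Function.comp]
  rw [e1, e2, e4, Matrix.trace_sub, Matrix.trace_smul, Matrix.trace_smul, Matrix.trace_smul,
    Matrix.trace_one, Fintype.card_fin]
  simp only [smul_eq_mul]
  field_simp

lemma aux_Ttmat {N n : ℕ} (σ : Fin N → Fin n → ℝ) (A : Matrix (Fin N) (Fin n) ℝ)
    (ψ : Fin N → ℂ → ℂ) (ψt : Fin n → ℂ → ℂ) (hsol : SolvesSystem σ A ψ ψt) :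
    Tendsto (fun y : ℝ => (y : ℂ) • Ttmat A ψ ψt (-(y : ℂ))) atTop (𝓝 1) := by
  have h1 : Tendsto (fun y : ℝ => Matrix.diagonal fun j => ((y : ℂ) * ψt j (-(y : ℂ)))⁻¹)
      atTop (𝓝 (1 : Matrix (Fin n) (Fin n) ℂ)) := by
    have hc : Continuous fun d : Fin n → ℂ => Matrix.diagonal d := continuous_id.matrix_diagonal
    have : Tendsto (fun y : ℝ => fun j => ((y : ℂ) * ψt j (-(y : ℂ)))⁻¹) atTop
        (𝓝 (fun _ => 1)) := by
      refine tendsto_pi_nhds.2 fun j => ?_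
      simpa using (aux_stieltjes (hsol.2.1 j)).inv₀ one_ne_zero
    have := (hc.tendsto _).comp this
    simpa [Function.comp_def] using this
  have h2 : Tendsto (fun y : ℝ => Matrix.diagonal fun i => ψ i (-(y : ℂ)))
      atTop (𝓝 (0 : Matrix (Fin N) (Fin N) ℂ)) := by
    have hc : Continuous fun d : Fin N → ℂ => Matrix.diagonal d := continuous_id.matrix_diagonal
    have : Tendsto (fun y : ℝ => fun i => ψ i (-(y : ℂ))) atTop
        (𝓝 (fun _ => 0)) := by
      refine tendsto_pi_nhds.2 fun j => ?_
      have := aux_cinv.mul (aux_stieltjes (hsol.1 j))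
      rw [zero_mul] at this
      refine this.congr' ?_
      filter_upwards [eventually_gt_atTop 0] with y hy
      have hy' : (y : ℂ) ≠ 0 := by exact_mod_cast hy.ne'
      field_simp
    have := (hc.tendsto _).comp this
    simpa [Function.comp_def] using this
  have h3 : Tendsto (fun y : ℝ => (Matrix.diagonal fun j => ((y : ℂ) * ψt j (-(y : ℂ)))⁻¹)
      + (A.map Complex.ofReal)ᵀ * Matrix.diagonal (fun i => ψ i (-(y : ℂ))) *
        A.map Complex.ofReal) atTop (𝓝 (1 : Matrix (Fin n) (Fin n) ℂ)) := by
    have hc : Continuous fun M : Matrix (Fin N) (Fin N) ℂ =>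
        (A.map Complex.ofReal)ᵀ * M * A.map Complex.ofReal := by fun_prop
    simpa using h1.add ((hc.tendsto 0).comp h2)
  obtain ⟨h4, h5⟩ := aux_inv h3
  have h6 : ∀ᶠ y : ℝ in atTop, ∀ j, (y : ℂ) * ψt j (-(y : ℂ)) ≠ 0 :=
    eventually_all.2 fun j => (aux_stieltjes (hsol.2.1 j)).eventually_ne one_ne_zero
  refine h4.congr' ?_
  filter_upwards [h5, h6, eventually_gt_atTop 0] with y hu hne hy
  have hy' : (y : ℂ) ≠ 0 := by exact_mod_cast hy.ne'
  apply Matrix.inv_eq_right_inv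
  have e1 : (Matrix.diagonal fun j => ψt j (-(y : ℂ)))⁻¹
      = Matrix.diagonal fun j => (ψt j (-(y : ℂ)))⁻¹ := by
    apply Matrix.inv_eq_right_inv
    rw [Matrix.diagonal_mul_diagonal, ← Matrix.diagonal_one]
    congr 1
    funext j
    exact mul_inv_cancel₀ (right_ne_zero_of_mul (hne j))
  have e2 : (Matrix.diagonal fun j => ψt j (-(y : ℂ)))⁻¹ - (-(y : ℂ)) •
      ((A.map Complex.ofReal)ᵀ * Matrix.diagonal (fun i => ψ i (-(y : ℂ))) * A.map Complex.ofReal)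
      = (y : ℂ) • ((Matrix.diagonal fun j => ((y : ℂ) * ψt j (-(y : ℂ)))⁻¹)
      + (A.map Complex.ofReal)ᵀ * Matrix.diagonal (fun i => ψ i (-(y : ℂ))) *
        A.map Complex.ofReal) := by
    rw [e1, smul_add, neg_smul, sub_neg_eq_add]
    congr 1
    rw [← Matrix.diagonal_smul]
    congr 1
    funext j
    simp only [Pi.smul_apply, smul_eq_mul, mul_inv]
    rw [mul_inv_cancel_left₀ hy']
  rw [Ttmat, e2]
  set C := ((Matrix.diagonal fun j => ((y : ℂ) * ψt j (-(y : ℂ)))⁻¹)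
      + (A.map Complex.ofReal)ᵀ * Matrix.diagonal (fun i => ψ i (-(y : ℂ))) *
        A.map Complex.ofReal)
  have e3 : ((y : ℂ) • C)⁻¹ = (y : ℂ)⁻¹ • C⁻¹ := by
    apply Matrix.inv_eq_right_inv
    rw [smul_mul_smul_comm, mul_inv_cancel₀ hy', one_smul, Matrix.mul_nonsing_inv _ hu]
  rw [e3, smul_smul, mul_inv_cancel₀ hy', one_smul, Matrix.mul_nonsing_inv _ hu]

lemma aux_Tmat {N n : ℕ} (σ : Fin N → Fin n → ℝ) (A : Matrix (Fin N) (Fin n) ℝ)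
    (ψ : Fin N → ℂ → ℂ) (ψt : Fin n → ℂ → ℂ) (hsol : SolvesSystem σ A ψ ψt) :
    ∃ B : ℝ → Matrix (Fin N) (Fin N) ℂ,
      (∀ᶠ y : ℝ in atTop, Tmat A ψ ψt (-(y : ℂ)) = ((y : ℂ) • 1 + B y)⁻¹) ∧
      Tendsto B atTop (𝓝 ((Matrix.diagonal fun i => (n : ℂ)⁻¹ * ∑ j, (σ i j : ℂ)^2)
        + A.map Complex.ofReal * (A.map Complex.ofReal)ᵀ)) := by
  refine ⟨fun y => (Matrix.diagonal fun i => (n : ℂ)⁻¹ *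
      ((Matrix.diagonal fun j => ((σ i j : ℂ))^2) * ((y : ℂ) • Ttmat A ψ ψt (-(y : ℂ)))).trace)
      + A.map Complex.ofReal * Matrix.diagonal (fun j => (y : ℂ) * ψt j (-(y : ℂ)))
        * (A.map Complex.ofReal)ᵀ, ?_, ?_⟩
  · have h6 : ∀ᶠ y : ℝ in atTop, ∀ i, (y : ℂ) * ψ i (-(y : ℂ)) ≠ 0 :=
      eventually_all.2 fun i => (aux_stieltjes (hsol.1 i)).eventually_ne one_ne_zero
    filter_upwards [h6, eventually_gt_atTop 0] with y hne hy
    rw [Tmat]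
    congr 1
    have e1 : (Matrix.diagonal fun i => ψ i (-(y : ℂ)))⁻¹
        = Matrix.diagonal fun i => (ψ i (-(y : ℂ)))⁻¹ := by
      apply Matrix.inv_eq_right_inv
      rw [Matrix.diagonal_mul_diagonal, ← Matrix.diagonal_one]
      congr 1
      funext j
      exact mul_inv_cancel₀ (right_ne_zero_of_mul (hne j))
    rw [e1, neg_smul, sub_neg_eq_add, ← add_assoc]
    congr 1
    · rw [← Matrix.diagonal_one, ← Matrix.diagonal_smul, Matrix.diagonal_add]
      congr 1
      funext i
      rw [(hsol.2.2 _ (aux_mem_off hy)).1 i]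
      simp only [Matrix.mul_smul, Matrix.trace_smul, smul_eq_mul, Pi.smul_apply]
      rw [inv_neg, inv_inv]
      ring
    · have : (Matrix.diagonal fun j => (y : ℂ) * ψt j (-(y : ℂ)))
        = (y : ℂ) • Matrix.diagonal fun j => ψt j (-(y : ℂ)) := by
        rw [← Matrix.diagonal_smul]; rfl
      rw [this, Matrix.mul_smul, Matrix.smul_mul]
  · have hc : ∀ m : ℕ, Continuous fun d : Fin m → ℂ => Matrix.diagonal d :=
      fun m => continuous_id.matrix_diagonal
    refine Tendsto.add ?_ ?_
    · refine ((hc N).tendsto _).comp (tendsto_pi_nhds.2 fun i => ?_)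
      refine Tendsto.const_mul _ ?_
      have hcc : Continuous fun M : Matrix (Fin n) (Fin n) ℂ =>
          ((Matrix.diagonal fun j => ((σ i j : ℂ))^2) * M).trace :=
        (continuous_const.mul continuous_id).matrix_trace
      have := (hcc.tendsto 1).comp (aux_Ttmat σ A ψ ψt hsol)
      rw [Matrix.mul_one, Matrix.trace_diagonal] at this
      exact this
    · have h1 : Tendsto (fun y : ℝ => fun j => (y : ℂ) * ψt j (-(y : ℂ))) atTop
          (𝓝 (fun _ => 1)) := tendsto_pi_nhds.2 fun j => aux_stieltjes (hsol.2.1 j)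
      have hcc : Continuous fun d : Fin n → ℂ =>
        A.map Complex.ofReal * Matrix.diagonal d * (A.map Complex.ofReal)ᵀ := by
        have := hc n
        fun_prop
      have := (hcc.tendsto _).comp h1
      rw [Matrix.diagonal_one, Matrix.mul_one] at this
      exact this

lemma aux_map_trace {N n : ℕ} (A : Matrix (Fin N) (Fin n) ℝ) :
    (A.map Complex.ofReal * (A.map Complex.ofReal)ᵀ).trace = (((A * Aᵀ).trace : ℝ) : ℂ) := by
  simp [Matrix.trace, Matrix.mul_apply]

lemma aux_trace {N n : ℕ} (A : Matrix (Fin N) (Fin n) ℝ) :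
    (A * Aᵀ).trace = ∑ i, ∑ j, (A i j)^2 := by
  simp [Matrix.trace, Matrix.mul_apply, sq]

/-- Lemma C.1: `E ∫ λ P_n(dλ) = ∫ λ π_n(dλ) = (Nn)⁻¹ ∑_{i,j} σ_ij² + N⁻¹ Tr(AAᵀ)`,
and this common value is at most `σ_max² + a_max²`. -/
theorem stmt_17
    {Ω : Type*} [MeasurableSpace Ω] (P : Measure Ω) [IsProbabilityMeasure P]
    (N n : ℕ) (hN : 0 < N) (hn : 0 < n)
    (X : Fin N → Fin n → Ω → ℝ)
    (hXmeas : ∀ i j, Measurable (X i j))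
    (hXint : ∀ i j, Integrable (X i j) P)
    (hXsq : ∀ i j, Integrable (fun ω => (X i j ω)^2) P)
    (hXmean : ∀ i j, ∫ ω, X i j ω ∂P = 0)
    (hXvar : ∀ i j, ∫ ω, (X i j ω)^2 ∂P = 1)
    (σ : Fin N → Fin n → ℝ) (σmax : ℝ) (hσ : ∀ i j, |σ i j| ≤ σmax)
    (A : Matrix (Fin N) (Fin n) ℝ) (amax : ℝ)
    (hAcol : ∀ k : Fin n, Real.sqrt (∑ i, (A i k)^2) ≤ amax)
    (hArow : ∀ l : Fin N, Real.sqrt (∑ j, (A l j)^2) ≤ amax)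
    (ψ : Fin N → ℂ → ℂ) (ψt : Fin n → ℂ → ℂ)
    (hsol : SolvesSystem σ A ψ ψt)
    -- the empirical eigenvalue distribution of `Σ Σᵀ`
    (Pemp : Ω → Measure ℝ)
    (hPemp_prob : ∀ ω, IsProbabilityMeasure (Pemp ω))
    (hPemp_supp : ∀ ω, Pemp ω (Set.Iio 0) = 0)
    (hPemp : ∀ ω, ∀ z ∈ offRplus,
      (∫ t, ((t : ℂ) - z)⁻¹ ∂(Pemp ω))
        = (N : ℂ)⁻¹ * (Qmat σ A (fun i j => X i j ω) z).trace)
    -- the probability measure with Stieltjes transform `N⁻¹ Tr T(z)`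
    (π : Measure ℝ)
    (hπ_prob : IsProbabilityMeasure π)
    (hπ_supp : π (Set.Iio 0) = 0)
    (hπ : ∀ z ∈ offRplus,
      (∫ t, ((t : ℂ) - z)⁻¹ ∂π) = (N : ℂ)⁻¹ * (Tmat A ψ ψt z).trace) :
    (∫ ω, (∫ t, t ∂(Pemp ω)) ∂P)
      = ((N : ℝ) * n)⁻¹ * (∑ i, ∑ j, (σ i j)^2) + (N : ℝ)⁻¹ * (A * Aᵀ).trace
    ∧ (∫ t, t ∂π)
      = ((N : ℝ) * n)⁻¹ * (∑ i, ∑ j, (σ i j)^2) + (N : ℝ)⁻¹ * (A * Aᵀ).trace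
    ∧ ((N : ℝ) * n)⁻¹ * (∑ i, ∑ j, (σ i j)^2) + (N : ℝ)⁻¹ * (A * Aᵀ).trace
        ≤ σmax^2 + amax^2 := by
  have hN0 : (0:ℝ) < N := by exact_mod_cast hN
  have hn0 : (0:ℝ) < n := by exact_mod_cast hn
  refine ⟨?_, ?_, ?_⟩
  · have h1 : ∀ ω, ∫ t, t ∂(Pemp ω) = (N : ℝ)⁻¹ *
        ∑ i, ∑ j, (σ i j * X i j ω / Real.sqrt n + A i j)^2 := by
      intro ω
      have := hPemp_prob ω
      refine aux_moment _ (hPemp_supp ω) _ ?_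
      set S := Sigma_mat σ A (fun i j => X i j ω) with hS
      have h2 := aux_resolvent hN (tendsto_const_nhds (x := S.map Complex.ofReal *
        (S.map Complex.ofReal)ᵀ) (f := (atTop : Filter ℝ)))
      rw [aux_map_trace, aux_trace] at h2
      have e : ((N : ℂ)⁻¹ * ((∑ i, ∑ j, (S i j)^2 : ℝ) : ℂ)) = (((N : ℝ)⁻¹ *
        ∑ i, ∑ j, (σ i j * X i j ω / Real.sqrt n + A i j)^2 : ℝ) : ℂ) := by
        simp [hS, Sigma_mat]
      rw [e] at h2
      refine h2.congr' ?_
      filter_upwards [eventually_gt_atTop 0] with y hy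
      rw [hPemp ω _ (aux_mem_off hy), Qmat, neg_smul, sub_neg_eq_add, add_comm]
    simp_rw [h1]
    rw [integral_const_mul]
    have hint : ∀ i j, Integrable (fun ω => (σ i j)^2 / n * (X i j ω)^2
        + (2 * σ i j * A i j / Real.sqrt n) * X i j ω + (A i j)^2) P := fun i j =>
      (((hXsq i j).const_mul _).add ((hXint i j).const_mul _)).add (integrable_const _)
    have hval : ∀ i j, ∫ ω, ((σ i j)^2 / n * (X i j ω)^2
        + (2 * σ i j * A i j / Real.sqrt n) * X i j ω + (A i j)^2) ∂P
        = (σ i j)^2 / n + (A i j)^2 := by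
      intro i j
      have hi : Integrable (fun ω => (σ i j)^2 / n * (X i j ω)^2
        + (2 * σ i j * A i j / Real.sqrt n) * X i j ω) P :=
        ((hXsq i j).const_mul _).add ((hXint i j).const_mul _)
      rw [integral_add hi (integrable_const _), integral_add ((hXsq i j).const_mul _) ((hXint i j).const_mul _),
        integral_const_mul, integral_const_mul, hXvar, hXmean]
      simp
    have hexp : ∀ i j ω, (σ i j * X i j ω / Real.sqrt n + A i j)^2 = (σ i j)^2 / n * (X i j ω)^2
        + (2 * σ i j * A i j / Real.sqrt n) * X i j ω + (A i j)^2 := by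
      intro i j ω
      rw [add_sq, div_pow, Real.sq_sqrt hn0.le]
      ring
    simp_rw [hexp]
    rw [integral_finsetSum _ fun i _ => integrable_finsetSum _ fun j _ => hint i j]
    simp_rw [integral_finsetSum _ fun j _ => hint _ j, hval]
    rw [aux_trace]
    simp_rw [Finset.sum_add_distrib, ← Finset.sum_div]
    field_simp
  · have := hπ_prob
    refine aux_moment _ hπ_supp _ ?_
    obtain ⟨B, hB, hlim⟩ := aux_Tmat σ A ψ ψt hsol
    have h2 := aux_resolvent hN hlim
    rw [Matrix.trace_add, aux_map_trace, Matrix.trace_diagonal] at h2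
    have e : (N : ℂ)⁻¹ * ((∑ i, (n : ℂ)⁻¹ * ∑ j, (σ i j : ℂ)^2) + (((A * Aᵀ).trace : ℝ) : ℂ))
        = ((((N : ℝ) * n)⁻¹ * (∑ i, ∑ j, (σ i j)^2) + (N : ℝ)⁻¹ * (A * Aᵀ).trace : ℝ) : ℂ) := by
      rw [← Finset.mul_sum]
      push_cast
      rw [mul_inv]
      ring
    rw [e] at h2
    refine h2.congr' ?_
    filter_upwards [hB, eventually_gt_atTop 0] with y hBy hy
    rw [hπ _ (aux_mem_off hy), hBy]
  · have hs : ∑ i, ∑ j, (σ i j)^2 ≤ (N : ℝ) * n * σmax^2 := by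
      calc ∑ i, ∑ j, (σ i j)^2 ≤ ∑ _i : Fin N, ∑ _j : Fin n, σmax^2 := by
            refine Finset.sum_le_sum fun i _ => Finset.sum_le_sum fun j _ => ?_
            rw [← sq_abs]
            exact pow_le_pow_left₀ (abs_nonneg _) (hσ i j) 2
        _ = (N : ℝ) * n * σmax^2 := by simp; ring
    have ha : (A * Aᵀ).trace ≤ (N : ℝ) * amax^2 := by
      rw [aux_trace]
      calc ∑ i, ∑ j, (A i j)^2 ≤ ∑ _i : Fin N, amax^2 := by
            refine Finset.sum_le_sum fun i _ => ?_
            exact (Real.sqrt_le_iff.1 (hArow i)).2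
        _ = (N : ℝ) * amax^2 := by simp
    refine add_le_add ?_ ?_
    · rw [inv_mul_le_iff₀ (by positivity)]; exact hs
    · rw [inv_mul_le_iff₀ (by positivity)]; exact ha
end
end
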